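/- Let F = F(A) be a free group of finite rank at least 2 with basis A. There exists a constant N (depending only on F) with the following property: for every non-orientable quadratic word Q over F, if the equation Q = 1 has a solution in F, then it has a solution φ such that for every variable x, the word length |φ(x)| with respect to A satisfies |φ(x)| ≤ N·|Q|¹⁶, where |Q| denotes the length of Q as a reduced word in the free group on A together with the variables. -/

import Mathlib

namespace Stmt8

/-- Word length of an element of the free group F(A) w.r.t. the basis A: the length of
its reduced word. -/
def len {r : ℕ} (g : FreeGroup (Fin r)) : ℕ := g.toWord.length

/-- Number of occurrences of the variable x (as x or x⁻¹) in the reduced word Q. -/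
def occ {r nv : ℕ} (Q : FreeGroup (Fin nv ⊕ Fin r)) (x : Fin nv) : ℕ :=
  (Q.toWord.filter fun l => decide (l.1 = Sum.inl x)).length

/-- Number of occurrences of the variable x with the given sign in the reduced word Q. -/
def occS {r nv : ℕ} (Q : FreeGroup (Fin nv ⊕ Fin r)) (x : Fin nv) (s : Bool) : ℕ :=
  (Q.toWord.filter fun l => decide (l.1 = Sum.inl x) && (l.2 == s)).length

/-- A solution of the equation Q = 1 in F = F(A): a homomorphism F(X ∪ A) → F
sending each a ∈ A to itself and killing Q. -/
def IsSol {r nv : ℕ} (Q : FreeGroup (Fin nv ⊕ Fin r))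
    (φ : FreeGroup (Fin nv ⊕ Fin r) →* FreeGroup (Fin r)) : Prop :=
  (∀ a : Fin r, φ (FreeGroup.of (Sum.inr a)) = FreeGroup.of a) ∧ φ Q = 1

end Stmt8

namespace Stmt8

/-- Words over an alphabet. -/
abbrev Wd (α : Type) := List (α × Bool)

/-- evaluation of a signed letter. -/
def evl {α H : Type} [Group H] (φ : α → H) (l : α × Bool) : H := cond l.2 (φ l.1) (φ l.1)⁻¹

/-- evaluation of a word. -/
def ev {α H : Type} [Group H] (φ : α → H) (w : Wd α) : H := (w.map (evl φ)).prod

/-- A length function on a group. -/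
structure LF (H : Type) [Group H] where
  ℓ : H → ℕ
  one : ℓ 1 = 0
  inv : ∀ g, ℓ g⁻¹ = ℓ g
  mul : ∀ g h, ℓ (g * h) ≤ ℓ g + ℓ h

section
variable {α β H K : Type} [Group H] [Group K]

@[simp] theorem ev_nil (φ : α → H) : ev φ [] = 1 := rfl
@[simp] theorem ev_cons (φ : α → H) (l) (w : Wd α) : ev φ (l :: w) = evl φ l * ev φ w := by
  simp [ev]
@[simp] theorem ev_append (φ : α → H) (v w : Wd α) : ev φ (v ++ w) = ev φ v * ev φ w := by
  simp [ev]
theorem evl_not (φ : α → H) (a : α) (b : Bool) : evl φ (a, !b) = (evl φ (a, b))⁻¹ := by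
  cases b <;> simp [evl]
@[simp] theorem ev_invRev (φ : α → H) (w : Wd α) : ev φ (FreeGroup.invRev w) = (ev φ w)⁻¹ := by
  induction w with
  | nil => simp [FreeGroup.invRev]
  | cons l w ih =>
    have : FreeGroup.invRev (l :: w) = FreeGroup.invRev w ++ [(l.1, !l.2)] := by
      simp [FreeGroup.invRev]
    rw [this, ev_append, ih]
    simp [evl_not]
theorem ev_congr {φ ψ : α → H} {w : Wd α} (h : ∀ l ∈ w, φ l.1 = ψ l.1) : ev φ w = ev ψ w := by
  unfold ev
  congr 1
  apply List.map_congr_left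
  intro l hl
  simp [evl, h l hl]
theorem ev_hom (f : H →* K) (φ : α → H) (w : Wd α) : f (ev φ w) = ev (fun a => f (φ a)) w := by
  induction w with
  | nil => simp
  | cons l w ih =>
    rw [ev_cons, ev_cons, map_mul, ih]
    rcases l with ⟨a, b⟩
    cases b <;> simp [evl]
theorem lift_mk_ev (φ : α → H) (w : Wd α) : FreeGroup.lift φ (FreeGroup.mk w) = ev φ w := by
  rw [FreeGroup.lift_mk]; rfl
theorem ev_of (w : Wd α) : ev (FreeGroup.of) w = FreeGroup.mk w := by
  rw [← lift_mk_ev]; exact FreeGroup.lift_of_apply _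

theorem LF.mul3 (L : LF H) (a b c : H) : L.ℓ (a * b * c) ≤ L.ℓ a + L.ℓ b + L.ℓ c := by
  have := L.mul (a*b) c; have := L.mul a b; omega

theorem LF.evl (L : LF H) (φ : α → H) (l : α × Bool) : L.ℓ (evl φ l) = L.ℓ (φ l.1) := by
  rcases l with ⟨a, b⟩
  cases b <;> simp [Stmt8.evl, L.inv]

theorem LF.ev (L : LF H) (φ : α → H) (w : Wd α) (k : ℕ) (h : ∀ l ∈ w, L.ℓ (φ l.1) ≤ k) :
    L.ℓ (ev φ w) ≤ w.length * k := by
  induction w with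
  | nil => simp [L.one]
  | cons l w ih =>
    rw [ev_cons]
    have h1 := L.mul (Stmt8.evl φ l) (Stmt8.ev φ w)
    rw [L.evl] at h1
    have h2 := h l (by simp)
    have h3 := ih (fun l hl => h l (by simp [hl]))
    simp only [List.length_cons]
    linarith

end

section
variable {α : Type} [DecidableEq α]

/-- Number of occurrences of a letter (with any sign). -/
def cnt (w : Wd α) (a : α) : ℕ := (w.map Prod.fst).count a

@[simp] theorem cnt_nil (a : α) : cnt ([] : Wd α) a = 0 := rfl
@[simp] theorem cnt_append (v w : Wd α) (a : α) : cnt (v ++ w) a = cnt v a + cnt w a := by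
  simp [cnt]
@[simp] theorem cnt_cons (l) (w : Wd α) (a : α) :
    cnt (l :: w) a = cnt w a + if l.1 = a then 1 else 0 := by
  simp [cnt, List.count_cons]
@[simp] theorem cnt_invRev (w : Wd α) (a : α) : cnt (FreeGroup.invRev w) a = cnt w a := by
  simp [cnt, FreeGroup.invRev, Function.comp_def]
theorem mem_invRev {w : Wd α} {l : α × Bool} (h : l ∈ FreeGroup.invRev w) : ∃ l' ∈ w, l'.1 = l.1 := by
  simp only [FreeGroup.invRev, List.mem_reverse, List.mem_map] at h
  obtain ⟨l', h, rfl⟩ := h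
  exact ⟨l', h, rfl⟩
theorem cnt_eq_zero {w : Wd α} {a : α} : cnt w a = 0 ↔ ∀ l ∈ w, l.1 ≠ a := by
  unfold cnt
  rw [List.count_eq_zero]
  simp only [List.mem_map]
  constructor
  · intro h l hl e; exact h ⟨l, hl, e⟩
  · rintro h ⟨l, hl, e⟩; exact h l hl e
theorem cnt_pos {w : Wd α} {a : α} : 0 < cnt w a ↔ ∃ l ∈ w, l.1 = a := by
  rw [Nat.pos_iff_ne_zero, Ne, cnt_eq_zero]; push Not; rfl
theorem cnt_count (w : Wd α) (a : α) : cnt w a = w.count (a, true) + w.count (a, false) := by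
  induction w with
  | nil => rfl
  | cons l w ih =>
    rcases l with ⟨b, s⟩
    rw [cnt_cons, List.count_cons, List.count_cons, ih]
    by_cases h : b = a <;> cases s <;> simp [h] <;> omega

theorem split_of_cnt_pos {w : Wd α} {a : α} (h : 0 < cnt w a) :
    ∃ A s C, w = A ++ (a, s) :: C ∧ cnt A a = 0 := by
  induction w with
  | nil => simp at h
  | cons l w ih =>
    by_cases hl : l.1 = a
    · refine ⟨[], l.2, w, ?_, rfl⟩
      simp [← hl]
    · have : 0 < cnt w a := by simpa [hl] using h
      obtain ⟨A, s, C, rfl, hA⟩ := ih this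
      exact ⟨l :: A, s, C, by simp, by simp [hA, hl]⟩

theorem split_two {w : Wd α} {a : α} (h : cnt w a = 2) :
    ∃ A s B s' C, w = A ++ (a, s) :: (B ++ (a, s') :: C) ∧ cnt A a = 0 ∧ cnt B a = 0 ∧ cnt C a = 0 := by
  obtain ⟨A, s, C, rfl, hA⟩ := split_of_cnt_pos (w := w) (a := a) (by omega)
  simp [hA] at h
  obtain ⟨B, s', C, rfl, hB⟩ := split_of_cnt_pos (w := C) (a := a) (by omega)
  simp [hB] at h
  exact ⟨A, s, B, s', C, rfl, hA, hB, h⟩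

theorem ev_update {H : Type} [Group H] (φ : α → H) (x : α) (g : H) {w : Wd α} (h : cnt w x = 0) :
    ev (Function.update φ x g) w = ev φ w := by
  apply ev_congr
  intro l hl
  rw [Function.update_of_ne]
  exact (cnt_eq_zero.1 h) l hl

theorem exists_evl {H : Type} [Group H] (φ : α → H) (x : α) (s : Bool) (g : H) :
    ∃ v, evl (Function.update φ x v) (x, s) = g := by
  cases s
  · exact ⟨g⁻¹, by simp [evl]⟩
  · exact ⟨g, by simp [evl]⟩

end
end Stmt8

namespace Stmt8

/-- The normal form expression. -/
def NF {α H : Type} [Group H] (φ : α → H) (Xs : List H) (UVs : List (H × H)) (ws : List H)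
    (C : List (Wd α)) (c₀ : Wd α) : H :=
  (Xs.map (fun x => x * x)).prod * (UVs.map (fun u => u.1 * u.2 * u.1⁻¹ * u.2⁻¹)).prod *
    (List.zipWith (fun w c => w * ev φ c * w⁻¹) ws C).prod * ev φ c₀

/-- All elements of the normal form have length at most B. -/
def NFB {H : Type} [Group H] (L : LF H) (Xs : List H) (UVs : List (H × H)) (ws : List H)
    (B : ℕ) : Prop :=
  (∀ x ∈ Xs, L.ℓ x ≤ B) ∧ (∀ u ∈ UVs, L.ℓ u.1 ≤ B ∧ L.ℓ u.2 ≤ B) ∧ (∀ w ∈ ws, L.ℓ w ≤ B)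

theorem NFB.mono {H : Type} [Group H] {L : LF H} {Xs : List H} {UVs : List (H × H)} {ws : List H}
    {B B' : ℕ} (h : NFB L Xs UVs ws B) (hB : B ≤ B') : NFB L Xs UVs ws B' :=
  ⟨fun x hx => (h.1 x hx).trans hB, fun u hu => ⟨(h.2.1 u hu).1.trans hB, (h.2.1 u hu).2.trans hB⟩,
    fun w hw => (h.2.2 w hw).trans hB⟩

/-- w reduces to the normal form with p squares, q commutators and coefficients C, c₀. -/
def Red {α : Type} [DecidableEq α] (S : Set α) (w : Wd α) (p q : ℕ) (C : List (Wd α)) (c₀ : Wd α) :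
    Prop :=
  (∀ c ∈ C, ∀ l ∈ c, l.1 ∉ S) ∧ (∀ l ∈ c₀, l.1 ∉ S) ∧
  (∀ a, a ∉ S → cnt (C.flatten ++ c₀) a = cnt w a) ∧
  (C.flatten ++ c₀).length ≤ w.length ∧ p + q + C.length ≤ w.length ∧
  (∀ (H : Type) [Group H] (L : LF H),
    (∀ (φ : α → H) (k : ℕ), (∀ l ∈ w, L.ℓ (φ l.1) ≤ k) →
      ∃ Xs UVs ws, Xs.length = p ∧ UVs.length = q ∧ ws.length = C.length ∧
        NFB L Xs UVs ws (3 * w.length * k) ∧ ev φ w = NF φ Xs UVs ws C c₀) ∧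
    (∀ (τ : α → H) (k B : ℕ), (∀ l ∈ w, l.1 ∉ S → L.ℓ (τ l.1) ≤ k) →
      ∀ Xs UVs ws, Xs.length = p → UVs.length = q → ws.length = C.length →
        NFB L Xs UVs ws B →
        ∃ φ : α → H, (∀ a, a ∉ S → φ a = τ a) ∧ ev φ w = NF τ Xs UVs ws C c₀ ∧
          ∀ l₁ l₂, l₁ ++ l₂ = w → L.ℓ (ev φ l₁) ≤ w.length * (2 * B + k)))

theorem pre_cases {γ : Type} {l₁ l₂ A R : List γ} {x : γ} (h : l₁ ++ l₂ = A ++ x :: R) :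
    (∃ r, l₁ ++ r = A) ∨ (∃ r, l₁ = A ++ x :: r ∧ r ++ l₂ = R) := by
  rcases List.append_eq_append_iff.1 h with ⟨a, ha, hb⟩ | ⟨c, hc, hd⟩
  · exact Or.inl ⟨a, ha.symm⟩
  · cases c with
    | nil => left; exact ⟨[], by simpa using hc⟩
    | cons y c =>
      simp at hd
      right
      obtain ⟨rfl, hd⟩ := hd
      exact ⟨c, hc, hd.symm⟩

variable {α : Type} [DecidableEq α]

theorem Red_base (S : Set α) (w : Wd α) (h : ∀ l ∈ w, l.1 ∉ S) : Red S w 0 0 [] w := by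
  refine ⟨by simp, h, by simp, by simp, by simp, ?_⟩
  intro H _ L
  refine ⟨?_, ?_⟩
  · intro φ k hk
    refine ⟨[], [], [], rfl, rfl, rfl, ?_, ?_⟩
    · simp [NFB]
    · simp [NF]
  · intro τ k B hk Xs UVs ws h1 h2 h3 _
    simp at h1 h2 h3
    subst h1 h2 h3
    refine ⟨τ, fun _ _ => rfl, by simp [NF], ?_⟩
    rintro l₁ l₂ rfl
    have := L.ev τ l₁ k (fun l hl => hk l (by simp [hl]) (h l (by simp [hl])))
    refine this.trans ?_
    apply Nat.mul_le_mul
    · simp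
    · omega

theorem Red_sq (S : Set α) (x : α) (hx : x ∈ S) (A B D : Wd α) (s : Bool) (hA : cnt A x = 0)
    (hB : cnt B x = 0) (hD : cnt D x = 0) (p q : ℕ) (C : List (Wd α)) (c₀ : Wd α)
    (h : Red S (A ++ (FreeGroup.invRev B ++ D)) p q C c₀) :
    Red S (A ++ (x, s) :: (B ++ (x, s) :: D)) (p + 1) q C c₀ := by
  obtain ⟨h1, h2, h3, h4, h5, h6⟩ := h
  simp only [List.length_append, List.length_cons, FreeGroup.invRev_length] at h4 h5
  refine ⟨h1, h2, ?_, ?_, ?_, ?_⟩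
  · intro a ha
    rw [h3 a ha]
    have : x ≠ a := fun e => ha (e ▸ hx)
    simp [this]
  · simp only [List.length_append, List.length_cons]; omega
  · simp only [List.length_append, List.length_cons]; omega
  intro H _ L
  obtain ⟨h7, h8⟩ := h6 H L
  refine ⟨?_, ?_⟩
  · intro φ k hk
    have hk' : ∀ l ∈ A ++ (FreeGroup.invRev B ++ D), L.ℓ (φ l.1) ≤ k := by
      intro l hl
      simp only [List.mem_append] at hl
      rcases hl with hl | hl | hl
      · exact hk l (by simp [hl])
      · obtain ⟨l', hl', e⟩ := mem_invRev hl
        rw [← e]; exact hk l' (by simp [hl'])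
      · exact hk l (by simp [hl])
    obtain ⟨Xs, UVs, ws, e1, e2, e3, e4, e5⟩ := h7 φ k hk'
    refine ⟨(ev φ A * evl φ (x, s) * ev φ B * (ev φ A)⁻¹) :: Xs, UVs, ws, by simp [e1], e2, e3,
      ?_, ?_⟩
    · have e4' := e4.mono (B' := 3 * (A ++ (x, s) :: (B ++ (x, s) :: D)).length * k) (by
        gcongr
        simp only [List.length_append, List.length_cons, FreeGroup.invRev_length]; omega)
      refine ⟨?_, e4'.2⟩
      intro g hg
      rcases List.mem_cons.1 hg with rfl | hg
      · have a1 := L.ev φ A k (fun l hl => hk l (by simp [hl]))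
        have a2 := L.ev φ B k (fun l hl => hk l (by simp [hl]))
        have a3 : L.ℓ (evl φ (x, s)) ≤ k := by
          rw [L.evl]; exact hk (x, s) (by simp)
        have a4 := L.mul (ev φ A * evl φ (x, s) * ev φ B) (ev φ A)⁻¹
        have a5 := L.mul3 (ev φ A) (evl φ (x, s)) (ev φ B)
        rw [L.inv] at a4
        simp only [List.length_append, List.length_cons]
        nlinarith
      · exact e4'.1 g hg
    · have : ev φ (A ++ (x, s) :: (B ++ (x, s) :: D)) =
        (ev φ A * evl φ (x, s) * ev φ B * (ev φ A)⁻¹) *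
        (ev φ A * evl φ (x, s) * ev φ B * (ev φ A)⁻¹) * ev φ (A ++ (FreeGroup.invRev B ++ D)) := by
        simp only [ev_append, ev_cons, ev_invRev]; group
      rw [this, e5]
      simp only [NF, List.map_cons, List.prod_cons, mul_assoc]
  · intro τ k Bd hk Xs' UVs ws f1 f2 f3 f4
    obtain ⟨X, Xs, rfl⟩ := List.exists_cons_of_length_eq_add_one f1
    have hk' : ∀ l ∈ A ++ (FreeGroup.invRev B ++ D), l.1 ∉ S → L.ℓ (τ l.1) ≤ k := by
      intro l hl hS
      simp only [List.mem_append] at hl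
      rcases hl with hl | hl | hl
      · exact hk l (by simp [hl]) hS
      · obtain ⟨l', hl', e⟩ := mem_invRev hl
        rw [← e] at hS ⊢; exact hk l' (by simp [hl']) hS
      · exact hk l (by simp [hl]) hS
    obtain ⟨φ, g1, g2, g3⟩ := h8 τ k Bd hk' Xs UVs ws (by simpa using f1) f2 f3
      ⟨fun y hy => f4.1 y (by simp [hy]), f4.2⟩
    have hX : L.ℓ X ≤ Bd := f4.1 X (by simp)
    obtain ⟨v, hv⟩ := exists_evl φ x s ((ev φ A)⁻¹ * X * ev φ A * (ev φ B)⁻¹)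
    have uA := ev_update φ x v hA
    have uB := ev_update φ x v hB
    have uD := ev_update φ x v hD
    refine ⟨Function.update φ x v, ?_, ?_, ?_⟩
    · intro a ha
      have hne : a ≠ x := fun e => ha (e ▸ hx)
      rw [Function.update_of_ne hne]
      exact g1 a ha
    · have : ev (Function.update φ x v) (A ++ (x, s) :: (B ++ (x, s) :: D)) =
        X * X * ev φ (A ++ (FreeGroup.invRev B ++ D)) := by
        simp only [ev_append, ev_cons, ev_invRev, uA, uB, uD, hv]; group
      rw [this, g2]
      simp only [NF, List.map_cons, List.prod_cons, mul_assoc]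
    · intro l₁ l₂ hl
      have key : ∀ n, n ≤ 2 → ∀ m m', m ++ m' = A ++ (FreeGroup.invRev B ++ D) →
          ev (Function.update φ x v) l₁ = X ^ n * ev φ m →
          L.ℓ (ev (Function.update φ x v) l₁) ≤
          (A ++ (x, s) :: (B ++ (x, s) :: D)).length * (2 * Bd + k) := by
        intro n hn m m' hm e
        rw [e]
        have t1 := g3 m m' hm
        have t2 : L.ℓ (X ^ n) ≤ 2 * Bd := by
          interval_cases n
          · simp [L.one]
          · simp; omega
          · rw [pow_two]; have := L.mul X X; omega
        have t3 := L.mul (X ^ n) (ev φ m)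
        simp only [List.length_append, List.length_cons, FreeGroup.invRev_length] at t1 ⊢
        nlinarith
      rcases pre_cases hl with ⟨r, hr⟩ | ⟨r, hr1, hr2⟩
      · refine key 0 (by omega) l₁ (r ++ (FreeGroup.invRev B ++ D)) (by simp [← hr]) ?_
        have : cnt l₁ x = 0 := by
          rw [← hr] at hA; simp at hA; exact hA.1
        simp [ev_update φ x v this]
      rcases pre_cases hr2 with ⟨r', hr'⟩ | ⟨r', hr1', hr2'⟩
      · refine key 1 (by omega) (A ++ FreeGroup.invRev r') (FreeGroup.invRev r ++ D) ?_ ?_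
        · rw [← hr', FreeGroup.invRev_append]; simp
        · have u1 : cnt r x = 0 := by
            rw [← hr'] at hB; simp at hB; exact hB.1
          rw [hr1]
          simp only [ev_append, ev_cons, ev_invRev, uA, ev_update φ x v u1, hv]
          rw [← hr']
          simp only [ev_append]
          group
      · refine key 2 (by omega) (A ++ (FreeGroup.invRev B ++ r')) l₂ ?_ ?_
        · simp [hr2']
        · have u1 : cnt r' x = 0 := by
            rw [← hr2'] at hD; simp at hD; exact hD.1
          rw [hr1, hr1']
          simp only [ev_append, ev_cons, ev_invRev, uA, uB, ev_update φ x v u1, hv]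
          rw [pow_two]
          group

set_option maxHeartbeats 1000000 in
theorem Red_comm (S : Set α) (y z : α) (hy : y ∈ S) (hz : z ∈ S) (hyz : y ≠ z)
    (a b c d e : Wd α) (s t : Bool)
    (hcy : cnt (a ++ (d ++ (c ++ (b ++ e)))) y = 0) (hcz : cnt (a ++ (d ++ (c ++ (b ++ e)))) z = 0)
    (q : ℕ) (C : List (Wd α)) (c₀ : Wd α)
    (h : Red S (a ++ (d ++ (c ++ (b ++ e)))) 0 q C c₀) :
    Red S (a ++ (y, s) :: (b ++ (z, t) :: (c ++ (y, !s) :: (d ++ (z, !t) :: e)))) 0 (q + 1) C c₀ := by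
  obtain ⟨h1, h2, h3, h4, h5, h6⟩ := h
  simp only [List.length_append] at h4 h5
  simp only [cnt_append, Nat.add_eq_zero_iff] at hcy hcz
  obtain ⟨ya, yd, yc, yb, ye⟩ := hcy
  obtain ⟨za, zd, zc, zb, ze⟩ := hcz
  refine ⟨h1, h2, ?_, ?_, ?_, ?_⟩
  · intro x hx
    rw [h3 x hx]
    have i1 : y ≠ x := fun e => hx (e ▸ hy)
    have i2 : z ≠ x := fun e => hx (e ▸ hz)
    simp [i1, i2]; omega
  · simp only [List.length_append, List.length_cons]; omega
  · simp only [List.length_append, List.length_cons]; omega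
  intro H _ L
  obtain ⟨h7, h8⟩ := h6 H L
  have hmem : ∀ l ∈ a ++ (d ++ (c ++ (b ++ e))),
      l ∈ (a ++ (y, s) :: (b ++ (z, t) :: (c ++ (y, !s) :: (d ++ (z, !t) :: e)))) := by
    intro l hl
    simp only [List.mem_append, List.mem_cons] at hl ⊢
    tauto
  refine ⟨?_, ?_⟩
  · intro φ k hk
    obtain ⟨Xs, UVs, ws, e1, e2, e3, e4, e5⟩ := h7 φ k (fun l hl => hk l (hmem l hl))
    have hnil : Xs = [] := by simpa using e1
    subst hnil
    refine ⟨[], ((ev φ a * evl φ (y, s)) * (ev φ (a ++ (d ++ c)))⁻¹,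
      (ev φ (a ++ (d ++ (c ++ b))) * evl φ (z, t)) * (ev φ (a ++ d))⁻¹) :: UVs,
      ws, rfl, by simp [e2], e3, ?_, ?_⟩
    · have e4' := e4.mono (B' := 3 * (a ++ (y, s) :: (b ++ (z, t) ::
        (c ++ (y, !s) :: (d ++ (z, !t) :: e)))).length * k) (by
        gcongr
        simp only [List.length_append, List.length_cons]; omega)
      refine ⟨by simp, ?_, e4'.2.2⟩
      intro g hg
      rcases List.mem_cons.1 hg with rfl | hg
      · have a1 := L.ev φ a k (fun l hl => hk l (by simp [hl]))
        have a2 := L.ev φ (a ++ (d ++ c)) k (fun l hl => hk l (hmem l (by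
          simp only [List.mem_append] at hl ⊢; tauto)))
        have a3 := L.ev φ (a ++ (d ++ (c ++ b))) k (fun l hl => hk l (hmem l (by
          simp only [List.mem_append] at hl ⊢; tauto)))
        have a4 := L.ev φ (a ++ d) k (fun l hl => hk l (hmem l (by
          simp only [List.mem_append] at hl ⊢; tauto)))
        have a5 : L.ℓ (evl φ (y, s)) ≤ k := by
          rw [L.evl]; exact hk (y, s) (by simp)
        have a6 : L.ℓ (evl φ (z, t)) ≤ k := by
          rw [L.evl]; exact hk (z, t) (by simp)
        have b1 := L.mul3 (ev φ a) (evl φ (y, s)) (ev φ (a ++ (d ++ c)))⁻¹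
        have b2 := L.mul3 (ev φ (a ++ (d ++ (c ++ b)))) (evl φ (z, t)) (ev φ (a ++ d))⁻¹
        rw [L.inv] at b1 b2
        simp only [List.length_append, List.length_cons] at a1 a2 a3 a4 ⊢
        have n1 := Nat.zero_le (a.length * k)
        have n2 := Nat.zero_le (b.length * k)
        have n3 := Nat.zero_le (c.length * k)
        have n4 := Nat.zero_le (d.length * k)
        have n5 := Nat.zero_le (e.length * k)
        constructor <;> linarith
      · exact e4'.2.1 g hg
    · simp only [NF, List.map_cons, List.prod_cons, List.map_nil, List.prod_nil, one_mul] at e5 ⊢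
      rw [mul_assoc] at e5
      rw [mul_assoc, mul_assoc, ← e5]
      simp only [ev_append, ev_cons, evl_not]
      group
  · intro τ k Bd hk Xs UVs' ws f1 f2 f3 f4
    have hnil : Xs = [] := by simpa using f1
    subst hnil
    obtain ⟨⟨U, V⟩, UVs, rfl⟩ := List.exists_cons_of_length_eq_add_one f2
    obtain ⟨φ, g1, g2, g3⟩ := h8 τ k Bd (fun l hl => hk l (hmem l hl)) [] UVs ws rfl
      (by simpa using f2) f3 ⟨by simp, fun y hy => f4.2.1 y (by simp [hy]), f4.2.2⟩
    have hU : L.ℓ U ≤ Bd := (f4.2.1 (U, V) (by simp)).1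
    have hV : L.ℓ V ≤ Bd := (f4.2.1 (U, V) (by simp)).2
    obtain ⟨v, hv⟩ := exists_evl φ y s ((ev φ a)⁻¹ * U * (ev φ a * ev φ d * ev φ c))
    obtain ⟨u, hu⟩ := exists_evl (Function.update φ y v) z t
      ((ev φ a * ev φ d * ev φ c * ev φ b)⁻¹ * V * (ev φ a * ev φ d))
    set ψ := Function.update (Function.update φ y v) z u with hψ
    have hv' : evl ψ (y, s) = (ev φ a)⁻¹ * U * (ev φ a * ev φ d * ev φ c) := by
      rw [← hv]
      simp only [evl, hψ, Function.update_of_ne hyz]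
    have upd : ∀ w : Wd α, cnt w y = 0 → cnt w z = 0 → ev ψ w = ev φ w := by
      intro w k1 k2
      rw [hψ, ev_update _ _ _ k2, ev_update _ _ _ k1]
    have ua := upd a ya za
    have ub := upd b yb zb
    have uc := upd c yc zc
    have ud := upd d yd zd
    have ue := upd e ye ze
    refine ⟨ψ, ?_, ?_, ?_⟩
    · intro x hx
      have hne : x ≠ y := fun e => hx (e ▸ hy)
      have hne' : x ≠ z := fun e => hx (e ▸ hz)
      rw [hψ, Function.update_of_ne hne', Function.update_of_ne hne]
      exact g1 x hx
    · simp only [NF, List.map_cons, List.prod_cons, List.map_nil, List.prod_nil, one_mul] at g2 ⊢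
      rw [mul_assoc] at g2
      rw [mul_assoc, mul_assoc, ← g2]
      simp only [ev_append, ev_cons, evl_not, ua, ub, uc, ud, ue, hv', hu]
      group
    · intro l₁ l₂ hl
      have key : ∀ G, L.ℓ G ≤ 4 * Bd → ∀ m m', m ++ m' = a ++ (d ++ (c ++ (b ++ e))) →
          ev ψ l₁ = G * ev φ m →
          L.ℓ (ev ψ l₁) ≤ (a ++ (y, s) :: (b ++ (z, t) ::
        (c ++ (y, !s) :: (d ++ (z, !t) :: e)))).length * (2 * Bd + k) := by
        intro G hG m m' hm e'
        rw [e']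
        have t1 := g3 m m' hm
        have t3 := L.mul G (ev φ m)
        simp only [List.length_append, List.length_cons] at t1 ⊢
        nlinarith
      have bU : L.ℓ U ≤ 4 * Bd := by omega
      have bUV : L.ℓ (U * V) ≤ 2 * Bd := by have := L.mul U V; omega
      have bUVU : L.ℓ (U * V * U⁻¹) ≤ 3 * Bd := by
        have := L.mul (U * V) U⁻¹; rw [L.inv] at this; omega
      have bUVUV : L.ℓ (U * V * U⁻¹ * V⁻¹) ≤ 4 * Bd := by
        have := L.mul (U * V * U⁻¹) V⁻¹; rw [L.inv] at this; omega
      rcases pre_cases hl with ⟨r, hr⟩ | ⟨r1, hr1, hl1⟩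
      · refine key 1 (by simp [L.one]) l₁ (r ++ (d ++ (c ++ (b ++ e)))) (by simp [← hr]) ?_
        rw [← hr] at ya za
        simp at ya za
        rw [one_mul, upd l₁ ya.1 za.1]
      rcases pre_cases hl1 with ⟨r, hr⟩ | ⟨r2, hr2, hl2⟩
      · refine key U bU (a ++ (d ++ (c ++ r1))) (r ++ e) (by simp [← hr]) ?_
        rw [← hr] at yb zb
        simp at yb zb
        rw [hr1]
        simp only [ev_append, ev_cons, ua, upd r1 yb.1 zb.1, hv']
        group
      rcases pre_cases hl2 with ⟨r, hr⟩ | ⟨r3, hr3, hl3⟩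
      · refine key (U * V) (by omega) (a ++ (d ++ r2)) (r ++ (b ++ e)) (by simp [← hr]) ?_
        rw [← hr] at yc zc
        simp at yc zc
        rw [hr1, hr2]
        simp only [ev_append, ev_cons, ua, ub, upd r2 yc.1 zc.1, hv', hu]
        group
      rcases pre_cases hl3 with ⟨r, hr⟩ | ⟨r4, hr4, hl4⟩
      · refine key (U * V * U⁻¹) (by omega) (a ++ r3) (r ++ (c ++ (b ++ e))) (by simp [← hr]) ?_
        rw [← hr] at yd zd
        simp at yd zd
        rw [hr1, hr2, hr3]
        simp only [ev_append, ev_cons, ua, ub, uc, evl_not, upd r3 yd.1 zd.1, hv', hu]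
        group
      · refine key (U * V * U⁻¹ * V⁻¹) bUVUV (a ++ (d ++ (c ++ (b ++ r4)))) l₂ (by simp [hl4]) ?_
        rw [← hl4] at ye ze
        simp at ye ze
        rw [hr1, hr2, hr3, hr4]
        simp only [ev_append, ev_cons, ua, ub, uc, ud, evl_not, upd r4 ye.1 ze.1, hv', hu]
        group

theorem Red_conj (S : Set α) (z : α) (hz : z ∈ S) (a b e : Wd α) (t : Bool)
    (za : cnt a z = 0) (ze : cnt e z = 0) (hb : ∀ l ∈ b, l.1 ∉ S)
    (C : List (Wd α)) (c₀ : Wd α) (h : Red S (a ++ e) 0 0 C c₀) :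
    Red S (a ++ (z, t) :: (b ++ (z, !t) :: e)) 0 0 (b :: C) c₀ := by
  obtain ⟨h1, h2, h3, h4, h5, h6⟩ := h
  simp only [List.length_append] at h4 h5
  have zb : cnt b z = 0 := cnt_eq_zero.2 (fun l hl e => hb l hl (e ▸ hz))
  refine ⟨?_, h2, ?_, ?_, ?_, ?_⟩
  · intro c hc
    rcases List.mem_cons.1 hc with rfl | hc
    · exact hb
    · exact h1 c hc
  · intro x hx
    have := h3 x hx
    have i2 : z ≠ x := fun e => hx (e ▸ hz)
    simp only [cnt_append, List.flatten_cons, cnt_cons, i2, if_false] at this ⊢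
    omega
  · simp only [List.flatten_cons, List.length_append, List.length_cons]; omega
  · simp only [List.length_append, List.length_cons]; omega
  intro H _ L
  obtain ⟨h7, h8⟩ := h6 H L
  have hmem : ∀ l ∈ a ++ e, l ∈ (a ++ (z, t) :: (b ++ (z, !t) :: e)) := by
    intro l hl
    simp only [List.mem_append, List.mem_cons] at hl ⊢
    tauto
  refine ⟨?_, ?_⟩
  · intro φ k hk
    obtain ⟨Xs, UVs, ws, e1, e2, e3, e4, e5⟩ := h7 φ k (fun l hl => hk l (hmem l hl))
    have hnil : Xs = [] := by simpa using e1
    subst hnil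
    have hnil : UVs = [] := by simpa using e2
    subst hnil
    refine ⟨[], [], (ev φ a * evl φ (z, t)) :: ws, rfl, rfl, by simp [e3], ?_, ?_⟩
    · have e4' := e4.mono (B' := 3 * (a ++ (z, t) :: (b ++ (z, !t) :: e)).length * k) (by
        gcongr
        simp only [List.length_append, List.length_cons]; omega)
      refine ⟨by simp, by simp, ?_⟩
      intro g hg
      rcases List.mem_cons.1 hg with rfl | hg
      · have a1 := L.ev φ a k (fun l hl => hk l (by simp [hl]))
        have a6 : L.ℓ (evl φ (z, t)) ≤ k := by
          rw [L.evl]; exact hk (z, t) (by simp)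
        have b1 := L.mul (ev φ a) (evl φ (z, t))
        simp only [List.length_append, List.length_cons] at a1 ⊢
        nlinarith
      · exact e4'.2.2 g hg
    · simp only [NF, List.zipWith_cons_cons, List.prod_cons, List.map_nil, List.prod_nil,
        one_mul] at e5 ⊢
      rw [mul_assoc, ← e5]
      simp only [ev_append, ev_cons, evl_not]
      group
  · intro τ k Bd hk Xs UVs ws' f1 f2 f3 f4
    have hnil : Xs = [] := by simpa using f1
    subst hnil
    have hnil : UVs = [] := by simpa using f2
    subst hnil
    obtain ⟨W, ws, rfl⟩ := List.exists_cons_of_length_eq_add_one f3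
    obtain ⟨φ, g1, g2, g3⟩ := h8 τ k Bd (fun l hl => hk l (hmem l hl)) [] [] ws rfl rfl
      (by simpa using f3) ⟨by simp, by simp, fun y hy => f4.2.2 y (by simp [hy])⟩
    have hW : L.ℓ W ≤ Bd := f4.2.2 W (by simp)
    obtain ⟨v, hv⟩ := exists_evl φ z t ((ev φ a)⁻¹ * W)
    have ua := ev_update φ z v za
    have ub := ev_update φ z v zb
    have ue := ev_update φ z v ze
    have ub' : ev φ b = ev τ b := ev_congr (fun l hl => g1 _ (hb l hl))
    refine ⟨Function.update φ z v, ?_, ?_, ?_⟩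
    · intro x hx
      have hne : x ≠ z := fun e => hx (e ▸ hz)
      rw [Function.update_of_ne hne]
      exact g1 x hx
    · simp only [NF, List.zipWith_cons_cons, List.prod_cons, List.map_nil, List.prod_nil,
        one_mul] at g2 ⊢
      rw [mul_assoc, ← g2]
      simp only [ev_append, ev_cons, evl_not, ua, ub, ub', ue, hv]
      group
    · have hbk : ∀ l ∈ b, L.ℓ (φ l.1) ≤ k := by
        intro l hl
        rw [g1 _ (hb l hl)]
        exact hk l (by simp [hl]) (hb l hl)
      intro l₁ l₂ hl
      rcases pre_cases hl with ⟨r, hr⟩ | ⟨r1, hr1, hl1⟩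
      · have t1 := g3 l₁ (r ++ e) (by simp [← hr])
        rw [← hr] at za
        simp at za
        rw [ev_update φ z v za.1]
        simp only [List.length_append, List.length_cons] at t1 ⊢
        nlinarith
      rcases pre_cases hl1 with ⟨r, hr⟩ | ⟨r2, hr2, hl2⟩
      · have zr : cnt r1 z = 0 := by
          rw [← hr] at zb; simp at zb; exact zb.1
        have : ev (Function.update φ z v) l₁ = W * ev φ r1 := by
          rw [hr1]
          simp only [ev_append, ev_cons, ua, ev_update φ z v zr, hv]
          group
        rw [this]
        have t1 := L.mul W (ev φ r1)
        have t2 := L.ev φ r1 k (fun l hl => hbk l (by rw [← hr]; simp [hl]))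
        have t3 : r1.length ≤ b.length := by rw [← hr]; simp
        simp only [List.length_append, List.length_cons]
        have t4 : r1.length * k ≤ b.length * k := Nat.mul_le_mul_right _ t3
        nlinarith
      · have zr : cnt r2 z = 0 := by
          rw [← hl2] at ze; simp at ze; exact ze.1
        have : ev (Function.update φ z v) l₁ = (W * ev φ b * W⁻¹) * ev φ (a ++ r2) := by
          rw [hr1, hr2]
          simp only [ev_append, ev_cons, evl_not, ua, ub, ev_update φ z v zr, hv]
          group
        rw [this]
        have t0 := L.mul (W * ev φ b * W⁻¹) (ev φ (a ++ r2))
        have t1 := L.mul3 W (ev φ b) W⁻¹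
        rw [L.inv] at t1
        have t2 := L.ev φ b k hbk
        have t3 := g3 (a ++ r2) l₂ (by simp [hl2])
        simp only [List.length_append, List.length_cons] at t3 ⊢
        nlinarith

end Stmt8

namespace Stmt8

/-- All letters of S occur at most once with each sign, and with balanced signs. -/
def Ori {α : Type} [DecidableEq α] (S : Set α) (w : Wd α) : Prop :=
  ∀ x ∈ S, w.count (x, true) = w.count (x, false) ∧ w.count (x, true) ≤ 1

section XN
variable {α : Type} [DecidableEq α]

theorem Ori.count_le {S : Set α} {w : Wd α} (h : Ori S w) {x : α} (hx : x ∈ S) (s : Bool) :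
    w.count (x, s) ≤ 1 := by
  have := h x hx
  cases s <;> omega

theorem Ori.cnt {S : Set α} {w : Wd α} (h : Ori S w) {x : α} (hx : x ∈ S) :
    cnt w x = 0 ∨ cnt w x = 2 := by
  have := h x hx
  rw [cnt_count]
  omega

theorem Ori.congr {S : Set α} {w w' : Wd α} (h : Ori S w)
    (e : ∀ x ∈ S, (∀ s, w'.count (x, s) = w.count (x, s)) ∨ (∀ s, w'.count (x, s) = 0)) :
    Ori S w' := by
  intro x hx
  have := h x hx
  rcases e x hx with e | e
  · rw [e, e]; exact this
  · rw [e, e]; simp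

theorem count_of_cnt {w : Wd α} {x : α} (h : cnt w x = 0) (s : Bool) : w.count (x, s) = 0 := by
  rw [cnt_count] at h
  cases s <;> omega

theorem sub_cons_map {x : α} {l : List α} {w : Wd α} (h : (x :: l).Sublist (w.map Prod.fst)) :
    ∃ a s r, w = a ++ (x, s) :: r ∧ l.Sublist (r.map Prod.fst) := by
  induction w with
  | nil => simp at h
  | cons y w ih =>
    rcases y with ⟨y, t⟩
    rw [List.map_cons] at h
    rcases List.sublist_cons_iff.1 h with h | ⟨r, hr, hr'⟩
    · obtain ⟨a, s, r, rfl, h'⟩ := ih h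
      exact ⟨(y, t) :: a, s, r, by simp, h'⟩
    · simp at hr
      obtain ⟨rfl, rfl⟩ := hr
      exact ⟨[], t, w, by simp, hr'⟩

theorem Ori.sign {S : Set α} {x : α} (hx : x ∈ S) {A B D : Wd α} {s s' : Bool}
    (h : Ori S (A ++ (x, s) :: (B ++ (x, s') :: D))) : s' = !s := by
  by_contra hne
  have : s' = s := by cases s <;> cases s' <;> simp_all
  subst this
  have := h.count_le hx s'
  simp [List.count_append, List.count_cons] at this
  omega

theorem XN3 (S : Set α) (n : ℕ) : ∀ w : Wd α, w.length ≤ n → Ori S w →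
    (∀ y ∈ S, ∀ z ∈ S, y ≠ z → ¬ [y, z, y, z].Sublist (w.map Prod.fst)) →
    ∃ C c₀, Red S w 0 0 C c₀ := by
  induction n with
  | zero =>
    intro w hw _ _
    have : w = [] := by simpa using hw
    subst this
    exact ⟨[], [], Red_base S [] (by simp)⟩
  | succ n ih =>
    intro w hw hO hU
    by_cases hS : ∀ l ∈ w, l.1 ∉ S
    · exact ⟨[], w, Red_base S w hS⟩
    push Not at hS
    obtain ⟨⟨x, s⟩, hl, hx⟩ := hS
    have hc : cnt w x = 2 := by
      rcases hO.cnt hx with h | h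
      · exact absurd rfl (cnt_eq_zero.1 h _ hl)
      · exact h
    have hex : ∃ m, ∃ z ∈ S, ∃ a t b t' e, w = a ++ (z, t) :: (b ++ (z, t') :: e) ∧ b.length = m := by
      obtain ⟨A, s, B, s', D, h, _⟩ := split_two hc
      exact ⟨_, x, hx, A, s, B, s', D, h, rfl⟩
    classical
    obtain ⟨z, hz, a, t, b, t', e, hw', hb⟩ := Nat.find_spec hex
    have hmin := fun m hm => Nat.find_min hex (m := m) hm
    rw [← hb] at hmin
    clear hb hc hl hx
    subst hw'
    have ht' := hO.sign hz
    subst ht'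
    have hcz : cnt a z = 0 ∧ cnt b z = 0 ∧ cnt e z = 0 := by
      have := hO.cnt hz
      simp at this
      omega
    have hbS : ∀ l ∈ b, l.1 ∉ S := by
      rintro ⟨y, u⟩ hl hy
      have hyz : y ≠ z := cnt_eq_zero.1 hcz.2.1 _ hl
      have hy1 : 0 < cnt b y := cnt_pos.2 ⟨_, hl, rfl⟩
      have hy2 : cnt a y + cnt b y + cnt e y = 2 := by
        have := hO.cnt hy
        simp [hyz.symm] at this
        omega
      by_cases hy3 : cnt b y = 2
      · obtain ⟨A, s1, B, s2, D, h, _⟩ := split_two hy3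
        refine hmin B.length ?_ ⟨y, hy, a ++ (z, t) :: A, s1, B, s2, D ++ (z, !t) :: e, ?_, rfl⟩
        · rw [h]; simp only [List.length_append, List.length_cons]; omega
        · rw [h]; simp
      have mb : y ∈ b.map Prod.fst := List.mem_map_of_mem hl
      by_cases hy4 : 0 < cnt a y
      · have ma : y ∈ a.map Prod.fst := by
          obtain ⟨l, h1, h2⟩ := cnt_pos.1 hy4
          rw [← h2]; exact List.mem_map_of_mem h1
        refine hU y hy z hz hyz ?_
        have : [y, z, y, z] = [y] ++ z :: ([y] ++ z :: []) := rfl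
        rw [this]
        simp only [List.map_append, List.map_cons]
        refine List.Sublist.append (List.singleton_sublist.2 ma) (List.Sublist.cons_cons _ ?_)
        refine List.Sublist.append (List.singleton_sublist.2 mb) (List.Sublist.cons_cons _ ?_)
        simp
      · have me : y ∈ e.map Prod.fst := by
          obtain ⟨l, h1, h2⟩ := cnt_pos.1 (show 0 < cnt e y by omega)
          rw [← h2]; exact List.mem_map_of_mem h1
        refine hU z hz y hy hyz.symm ?_
        have : [z, y, z, y] = [] ++ z :: ([y] ++ z :: [y]) := rfl
        rw [this]
        simp only [List.map_append, List.map_cons]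
        refine List.Sublist.append (by simp) (List.Sublist.cons_cons _ ?_)
        refine List.Sublist.append (List.singleton_sublist.2 mb) (List.Sublist.cons_cons _ ?_)
        exact List.singleton_sublist.2 me
    have hsub : (a ++ e).Sublist (a ++ (z, t) :: (b ++ (z, !t) :: e)) := by
      refine List.Sublist.append_left ?_ _
      refine List.Sublist.cons _ ?_
      refine List.Sublist.trans ?_ (List.sublist_append_right _ _)
      exact List.Sublist.cons _ (List.Sublist.refl _)
    obtain ⟨C, c₀, hR⟩ := ih (a ++ e) (by
        simp only [List.length_append, List.length_cons] at hw ⊢; omega) (by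
        refine hO.congr ?_
        intro x hx
        by_cases hxz : x = z
        · right
          intro s
          subst hxz
          simp [count_of_cnt hcz.1, count_of_cnt hcz.2.2]
        · left
          intro s
          have : b.count (x, s) = 0 := by
            rw [List.count_eq_zero]
            intro hm
            exact hbS _ hm hx
          simp [List.count_cons, this, Ne.symm hxz]) (by
        intro y hy z' hz' hne hs
        exact hU y hy z' hz' hne (hs.trans (hsub.map _)))
    exact ⟨_, _, Red_conj S z hz a b e t hcz.1 hcz.2.2 hbS C c₀ hR⟩

theorem XN2 (S : Set α) (n : ℕ) : ∀ w : Wd α, w.length ≤ n → Ori S w →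
    ∃ q C c₀, Red S w 0 q C c₀ := by
  induction n with
  | zero =>
    intro w hw _
    have : w = [] := by simpa using hw
    subst this
    exact ⟨0, [], [], Red_base S [] (by simp)⟩
  | succ n ih =>
    intro w hw hO
    by_cases hU : (∀ y ∈ S, ∀ z ∈ S, y ≠ z → ¬ [y, z, y, z].Sublist (w.map Prod.fst))
    · obtain ⟨C, c₀, h⟩ := XN3 S _ w hw hO hU
      exact ⟨0, C, c₀, h⟩
    push Not at hU
    obtain ⟨y, hy, z, hz, hyz, hs⟩ := hU
    obtain ⟨a, s, r, rfl, hs1⟩ := sub_cons_map hs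
    obtain ⟨b, t, r, rfl, hs2⟩ := sub_cons_map hs1
    obtain ⟨c, s', r, rfl, hs3⟩ := sub_cons_map hs2
    obtain ⟨d, t', e, rfl, hs4⟩ := sub_cons_map hs3
    clear hs hs1 hs2 hs3 hs4
    have hs' : s' = !s := by
      refine Ori.sign (S := S) hy (A := a) (B := b ++ (z, t) :: c) (D := d ++ (z, t') :: e) ?_
      simpa using hO
    have ht' : t' = !t := by
      refine Ori.sign (S := S) hz (A := a ++ (y, s) :: b) (B := c ++ (y, s') :: d) (D := e) ?_
      simpa using hO
    subst hs' ht'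
    have hcy := hO.cnt hy
    have hcz := hO.cnt hz
    simp [hyz, hyz.symm] at hcy hcz
    have hcy' : cnt (a ++ (d ++ (c ++ (b ++ e)))) y = 0 := by simp; omega
    have hcz' : cnt (a ++ (d ++ (c ++ (b ++ e)))) z = 0 := by simp; omega
    obtain ⟨q, C, c₀, hR⟩ := ih (a ++ (d ++ (c ++ (b ++ e)))) (by
        simp only [List.length_append, List.length_cons] at hw ⊢; omega) (by
        refine hO.congr ?_
        intro x hx
        by_cases hxz : x = z
        · right
          intro s
          subst hxz
          exact count_of_cnt hcz' s
        by_cases hxy : x = y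
        · right
          intro s
          subst hxy
          exact count_of_cnt hcy' s
        · left
          intro u
          simp [List.count_cons, Ne.symm hxz, Ne.symm hxy]
          omega)
    exact ⟨_, _, _, Red_comm S y z hy hz hyz a b c d e s t hcy' hcz' q C c₀ hR⟩

theorem XN1 (S : Set α) (n : ℕ) : ∀ w : Wd α, w.length ≤ n → (∀ x ∈ S, cnt w x = 0 ∨ cnt w x = 2) →
    ∃ p q C c₀, Red S w p q C c₀ ∧ (¬ Ori S w → 1 ≤ p) := by
  induction n with
  | zero =>
    intro w hw _
    have : w = [] := by simpa using hw
    subst this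
    exact ⟨0, 0, [], [], Red_base S [] (by simp), fun h => absurd (by simp [Ori]) h⟩
  | succ n ih =>
    intro w hw h2
    by_cases hO : Ori S w
    · obtain ⟨q, C, c₀, h⟩ := XN2 S _ w hw hO
      exact ⟨0, q, C, c₀, h, fun h => absurd hO h⟩
    have : ∃ x ∈ S, ∃ A s B D, w = A ++ (x, s) :: (B ++ (x, s) :: D) ∧ cnt A x = 0 ∧ cnt B x = 0 ∧
        cnt D x = 0 := by
      by_contra hcon
      apply hO
      intro x hx
      rcases h2 x hx with h | h
      · simp [count_of_cnt h]
      · obtain ⟨A, s, B, s', D, e, hA, hB, hD⟩ := split_two h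
        by_cases hss : s = s'
        · subst hss
          exact absurd ⟨x, hx, A, s, B, D, e, hA, hB, hD⟩ hcon
        · rw [e]
          cases s <;> cases s' <;>
            simp_all [List.count_cons, count_of_cnt hA, count_of_cnt hB, count_of_cnt hD]
    obtain ⟨x, hx, A, s, B, D, rfl, hA, hB, hD⟩ := this
    obtain ⟨p, q, C, c₀, hR, _⟩ := ih (A ++ (FreeGroup.invRev B ++ D)) (by
        simp only [List.length_append, List.length_cons, FreeGroup.invRev_length] at hw ⊢; omega) (by
        intro y hy
        by_cases hxy : y = x
        · subst hxy
          left; simp [hA, hB, hD]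
        · have := h2 y hy
          simp [Ne.symm hxy] at this ⊢
          exact this)
    exact ⟨_, _, _, _, Red_sq S x hx A B D s hA hB hD p q C c₀ hR, fun _ => by omega⟩

theorem XN (S : Set α) (w : Wd α) (h : ∀ x ∈ S, cnt w x = 0 ∨ cnt w x = 2) :
    ∃ p q C c₀, Red S w p q C c₀ ∧ ((∃ x ∈ S, ∃ s, w.count (x, s) = 2) → 1 ≤ p) := by
  obtain ⟨p, q, C, c₀, h1, h2⟩ := XN1 S _ w le_rfl h
  refine ⟨p, q, C, c₀, h1, ?_⟩
  rintro ⟨x, hx, s, e⟩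
  apply h2
  intro hO
  have := hO.count_le hx s
  omega

end XN
end Stmt8

namespace Stmt8

/-- product of squares -/
def sqp {H : Type} [Group H] (Xs : List H) : H := (Xs.map (fun x => x * x)).prod

/-- product of commutators -/
def cmp {H : Type} [Group H] (UVs : List (H × H)) : H :=
  (UVs.map (fun u => u.1 * u.2 * u.1⁻¹ * u.2⁻¹)).prod

section Conv
variable {H : Type} [Group H]

@[simp] theorem sqp_nil : sqp ([] : List H) = 1 := rfl
@[simp] theorem sqp_cons (x : H) (Xs : List H) : sqp (x :: Xs) = x * x * sqp Xs := by simp [sqp]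
@[simp] theorem sqp_append (Xs Ys : List H) : sqp (Xs ++ Ys) = sqp Xs * sqp Ys := by simp [sqp]
@[simp] theorem cmp_nil : cmp ([] : List (H × H)) = 1 := rfl
@[simp] theorem cmp_cons (u : H × H) (Us : List (H × H)) :
    cmp (u :: Us) = u.1 * u.2 * u.1⁻¹ * u.2⁻¹ * cmp Us := by simp [cmp]

theorem conv1 (L : LF H) (W : ℕ) (UVs : List (H × H)) : ∀ (s : H) (a : ℕ), L.ℓ s ≤ a →
    (∀ u ∈ UVs, L.ℓ u.1 ≤ W ∧ L.ℓ u.2 ≤ W) →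
    ∃ Xs : List H, Xs.length = 2 * UVs.length + 1 ∧ s * s * cmp UVs = sqp Xs ∧
      ∀ x ∈ Xs, L.ℓ x ≤ 3 * a + 9 * (W * UVs.length) + 5 * W := by
  induction UVs with
  | nil =>
    intro s a hs _
    exact ⟨[s], rfl, by simp, by simp; omega⟩
  | cons u UVs ih =>
    intro s a hs hu
    rcases u with ⟨y, z⟩
    obtain ⟨hy, hz⟩ := hu (y, z) (by simp)
    simp only at hy hz
    have iy := L.inv y
    have iz := L.inv z
    have is := L.inv s
    obtain ⟨Xs, h1, h2, h3⟩ := ih (z⁻¹ * y⁻¹ * s⁻¹ * y) (a + 3 * W) (by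
      have := L.mul (z⁻¹ * y⁻¹ * s⁻¹) y
      have := L.mul3 z⁻¹ y⁻¹ s⁻¹
      omega) (fun u hu' => hu u (by simp [hu']))
    refine ⟨(s * s * (y * z * y⁻¹ * z⁻¹) * y⁻¹ * s⁻¹) :: (s * y * z) :: Xs, by simp [h1]; omega, ?_, ?_⟩
    · simp only [sqp_cons, cmp_cons, ← h2]
      group
    · intro x hx
      simp only [List.length_cons]
      rcases List.mem_cons.1 hx with rfl | hx
      · have := L.mul3 (s * s * (y * z * y⁻¹ * z⁻¹)) y⁻¹ s⁻¹
        have := L.mul3 s s (y * z * y⁻¹ * z⁻¹)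
        have := L.mul (y * z * y⁻¹) z⁻¹
        have := L.mul3 y z y⁻¹
        have := Nat.zero_le (W * UVs.length)
        rw [Nat.mul_add]
        omega
      rcases List.mem_cons.1 hx with rfl | hx
      · have := L.mul3 s y z
        rw [Nat.mul_add]
        omega
      · have := h3 x hx
        rw [Nat.mul_add]
        omega

theorem conv2 (L : LF H) (W : ℕ) (q : ℕ) : ∀ (Xs : List H), Xs.length = 2 * q + 1 →
    (∀ x ∈ Xs, L.ℓ x ≤ W) →
    ∃ (s : H) (UVs : List (H × H)), UVs.length = q ∧ sqp Xs = s * s * cmp UVs ∧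
      L.ℓ s ≤ W * (1 + 4 * q) ∧
      ∀ u ∈ UVs, L.ℓ u.1 ≤ 2 * (W * (1 + 4 * q)) + 6 * W ∧ L.ℓ u.2 ≤ 2 * (W * (1 + 4 * q)) + 6 * W := by
  induction q with
  | zero =>
    intro Xs h hW
    obtain ⟨s, rfl⟩ := List.length_eq_one_iff.1 h
    exact ⟨s, [], rfl, by simp, by simpa using hW, by simp⟩
  | succ q ih =>
    intro Xs h hW
    obtain ⟨A, Xs, rfl⟩ := List.exists_cons_of_length_eq_add_one h
    obtain ⟨B, Xs, rfl⟩ := List.exists_cons_of_length_pos (l := Xs) (by simp at h; omega)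
    obtain ⟨D, UVs, h1, h2, h3, h4⟩ := ih Xs (by simp at h; omega) (fun x hx => hW x (by simp [hx]))
    have hA : L.ℓ A ≤ W := hW A (by simp)
    have hB : L.ℓ B ≤ W := hW B (by simp)
    have iB := L.inv B
    have e1 : W * (1 + 4 * (q + 1)) = W * (1 + 4 * q) + 4 * W := by ring
    rw [e1]
    have b1 := L.mul3 A (B * B) (D * B⁻¹)
    have b2 := L.mul B B
    have b3 := L.mul D B⁻¹
    have b4 := L.mul B D
    have b5 := L.mul3 (B * D)⁻¹ (A * (B * B) * (D * B⁻¹))⁻¹ B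
    rw [L.inv, L.inv] at b5
    refine ⟨A * (B * B) * (D * B⁻¹),
      (B * D, (B * D)⁻¹ * (A * (B * B) * (D * B⁻¹))⁻¹ * B) :: UVs, by simp [h1], ?_, by omega, ?_⟩
    · simp only [sqp_cons, cmp_cons, h2]
      group
      simp only [zpow_ofNat, pow_two, mul_assoc]
    · intro u hu
      rcases List.mem_cons.1 hu with rfl | hu
      · simp only
        omega
      · have := h4 u hu
        omega

theorem convA (L : LF H) (W : ℕ) (p : ℕ) (Xs : List H) (UVs : List (H × H)) (hp : 1 ≤ p)
    (hX : Xs.length = p) (h1 : ∀ x ∈ Xs, L.ℓ x ≤ W)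
    (h2 : ∀ u ∈ UVs, L.ℓ u.1 ≤ W ∧ L.ℓ u.2 ≤ W) :
    ∃ Ys : List H, Ys.length = p + 2 * UVs.length ∧ sqp Xs * cmp UVs = sqp Ys ∧
      ∀ y ∈ Ys, L.ℓ y ≤ W * (9 * UVs.length + 8) := by
  obtain ⟨Xs', s, rfl⟩ : ∃ Xs' s, Xs = Xs' ++ [s] := by
    rcases List.eq_nil_or_concat Xs with rfl | ⟨l, b, h⟩
    · simp at hX; omega
    · exact ⟨l, b, by simpa using h⟩
  obtain ⟨Ys, a1, a2, a3⟩ := conv1 L W UVs s W (h1 s (by simp)) h2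
  refine ⟨Xs' ++ Ys, ?_, ?_, ?_⟩
  · simp at hX; simp [a1]; omega
  · simp [← a2, mul_assoc]
  · intro y hy
    have e : W * (9 * UVs.length + 8) = 9 * (W * UVs.length) + 8 * W := by ring
    rw [e]
    rcases List.mem_append.1 hy with hy | hy
    · have := h1 y (by simp [hy])
      omega
    · have := a3 y hy
      omega

theorem convB (L : LF H) (W : ℕ) (p q : ℕ) (Ys : List H) (hp : 1 ≤ p)
    (hY : Ys.length = p + 2 * q) (h1 : ∀ x ∈ Ys, L.ℓ x ≤ W) :
    ∃ (Xs : List H) (UVs : List (H × H)), Xs.length = p ∧ UVs.length = q ∧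
      sqp Ys = sqp Xs * cmp UVs ∧ (∀ x ∈ Xs, L.ℓ x ≤ W * (8 * q + 8)) ∧
      (∀ u ∈ UVs, L.ℓ u.1 ≤ W * (8 * q + 8) ∧ L.ℓ u.2 ≤ W * (8 * q + 8)) := by
  obtain ⟨s, UVs, a1, a2, a3, a4⟩ := conv2 L W q (Ys.drop (p - 1)) (by simp; omega)
    (fun x hx => h1 x (List.mem_of_mem_drop hx))
  have e : W * (8 * q + 8) = 2 * (W * (1 + 4 * q)) + 6 * W := by ring
  rw [e]
  refine ⟨Ys.take (p - 1) ++ [s], UVs, by simp; omega, a1, ?_, ?_, a4⟩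
  · conv_lhs => rw [← List.take_append_drop (p - 1) Ys, sqp_append, a2]
    simp [mul_assoc]
  · intro x hx
    rcases List.mem_append.1 hx with hx | hx
    · have := h1 x (List.mem_of_mem_take hx)
      omega
    · simp at hx
      subst hx
      omega

end Conv
end Stmt8

namespace Stmt8

/-- index type -/
abbrev Ix (p q : ℕ) := Fin p ⊕ (Fin q × Bool)

/-- the involution on the index type -/
def sg {p q : ℕ} : Ix p q → Ix p q
  | Sum.inl i => Sum.inl i
  | Sum.inr (j, b) => Sum.inr (j, !b)

theorem sg_sg {p q : ℕ} (a : Ix p q) : sg (sg a) = a := by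
  rcases a with i | ⟨j, b⟩ <;> simp [sg]

theorem zmod2_sq (x : ZMod 2) : x * x = x := by
  revert x; decide

theorem LA (p q : ℕ) (vs : List (Ix p q → ZMod 2))
    (hM : ∀ a b, (vs.map (fun v => v a * v b)).sum = if sg a = b then 1 else 0) :
    p + 2 * q ≤ vs.length ∧ (p = 0 → 1 ≤ vs.length → 2 * q + 1 ≤ vs.length) := by
  have hM' : ∀ a b, ∑ i : Fin vs.length, vs[i] a * vs[i] b = if sg a = b then 1 else 0 := by
    intro a b
    rw [← hM a b]
    exact Fin.sum_univ_fun_getElem vs (fun v => v a * v b)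
  let f : (Ix p q → ZMod 2) →ₗ[ZMod 2] (Fin vs.length → ZMod 2) :=
    { toFun := fun x i => ∑ a, vs[i] a * x a
      map_add' := by
        intro x y; funext i
        simp [mul_add, Finset.sum_add_distrib]
      map_smul' := by
        intro c x; funext i
        simp only [Pi.smul_apply, smul_eq_mul, RingHom.id_apply, Finset.mul_sum]
        refine Finset.sum_congr rfl (fun a _ => by ring) }
  have hinj : Function.Injective f := by
    rw [← LinearMap.ker_eq_bot, LinearMap.ker_eq_bot']
    intro x hx
    funext b
    have h1 : ∑ i : Fin vs.length, f x i * vs[i] (sg b) = 0 := by simp [hx]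
    have h2 : ∑ i : Fin vs.length, f x i * vs[i] (sg b) = x b := by
      simp only [f, LinearMap.coe_mk, AddHom.coe_mk, Finset.sum_mul]
      rw [Finset.sum_comm]
      have : ∀ a, ∑ i : Fin vs.length, vs[i] a * x a * vs[i] (sg b) =
          if a = b then x a else 0 := by
        intro a
        have : ∀ i : Fin vs.length, vs[i] a * x a * vs[i] (sg b) = (vs[i] a * vs[i] (sg b)) * x a := by
          intro i; ring
        simp only [this]
        rw [← Finset.sum_mul, hM']
        by_cases hab : a = b
        · simp [hab]
        · have : sg a ≠ sg b := fun e => hab (by rw [← sg_sg a, e, sg_sg])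
          simp [hab, this]
      simp only [this]
      simp
    rw [← h2, h1]; rfl
  have hc := LinearMap.finrank_le_finrank_of_injective hinj
  simp only [Module.finrank_fintype_fun_eq_card, Fintype.card_sum, Fintype.card_prod,
    Fintype.card_fin, Fintype.card_bool] at hc
  refine ⟨by omega, ?_⟩
  rintro rfl hP
  by_contra hlt
  have heq : Module.finrank (ZMod 2) (Ix 0 q → ZMod 2) =
      Module.finrank (ZMod 2) (Fin vs.length → ZMod 2) := by
    simp only [Module.finrank_fintype_fun_eq_card, Fintype.card_sum, Fintype.card_prod,
      Fintype.card_fin, Fintype.card_bool]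
    omega
  have hsurj := (LinearMap.injective_iff_surjective_of_finrank_eq_finrank heq).1 hinj
  obtain ⟨x, hx⟩ := hsurj (Pi.single ⟨0, hP⟩ 1)
  have h1 : ∑ i : Fin vs.length, f x i = 1 := by
    rw [hx]; simp
  have h2 : ∑ i : Fin vs.length, f x i = 0 := by
    simp only [f, LinearMap.coe_mk, AddHom.coe_mk]
    rw [Finset.sum_comm]
    apply Finset.sum_eq_zero
    intro a _
    rw [← Finset.sum_mul]
    have : ∑ i : Fin vs.length, vs[i] a = 0 := by
      have h3 := hM' a a
      simp only [zmod2_sq] at h3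
      rw [h3]
      rcases a with i | ⟨j, b⟩
      · exact i.elim0
      · simp [sg]
    rw [this, zero_mul]
  rw [h1] at h2
  exact one_ne_zero h2

/-- A two step nilpotent group. -/
@[ext] structure Nil (ι : Type) where
  v : ι → ZMod 2
  B : ι → ι → ZMod 2

instance (ι : Type) : Group (Nil ι) where
  mul x y := ⟨x.v + y.v, fun a b => x.B a b + y.B a b + x.v a * y.v b⟩
  one := ⟨0, 0⟩
  inv x := ⟨-x.v, fun a b => - x.B a b + x.v a * x.v b⟩
  mul_assoc x y z := by
    ext a b
    · show x.v a + y.v a + z.v a = x.v a + (y.v a + z.v a)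
      ring
    · show (x.B a b + y.B a b + x.v a * y.v b) + z.B a b + (x.v a + y.v a) * z.v b =
        x.B a b + (y.B a b + z.B a b + y.v a * z.v b) + x.v a * (y.v b + z.v b)
      ring
  one_mul x := by
    ext a b
    · show 0 + x.v a = x.v a
      ring
    · show 0 + x.B a b + 0 * x.v b = x.B a b
      ring
  mul_one x := by
    ext a b
    · show x.v a + 0 = x.v a
      ring
    · show x.B a b + 0 + x.v a * 0 = x.B a b
      ring
  inv_mul_cancel x := by
    ext a b
    · show - x.v a + x.v a = 0
      ring
    · show (- x.B a b + x.v a * x.v b) + x.B a b + (- x.v a) * x.v b = 0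
      ring

section
variable {ι : Type}
theorem Nil.mul_v (x y : Nil ι) (a : ι) : (x * y).v a = x.v a + y.v a := rfl
theorem Nil.mul_B (x y : Nil ι) (a b : ι) : (x * y).B a b = x.B a b + y.B a b + x.v a * y.v b := rfl
theorem Nil.one_v (a : ι) : (1 : Nil ι).v a = 0 := rfl
theorem Nil.one_B (a b : ι) : (1 : Nil ι).B a b = 0 := rfl
theorem Nil.inv_v (x : Nil ι) (a : ι) : (x⁻¹).v a = - x.v a := rfl
theorem Nil.inv_B (x : Nil ι) (a b : ι) : (x⁻¹).B a b = - x.B a b + x.v a * x.v b := rfl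

theorem zmod2_neg (x : ZMod 2) : -x = x := by
  revert x; decide
theorem zmod2_add (x : ZMod 2) : x + x = 0 := by
  revert x; decide

/-- product of a list of elements with trivial abelian part. -/
theorem Nil.prod_B {γ : Type} (l : List γ) (f : γ → Nil ι) (h : ∀ x ∈ l, ∀ a, (f x).v a = 0) (a b : ι) :
    (l.map f).prod.v a = 0 ∧ (l.map f).prod.B a b = (l.map (fun x => (f x).B a b)).sum := by
  induction l with
  | nil => simp [Nil.one_v, Nil.one_B]
  | cons x l ih =>
    have ih' := ih (fun y hy => h y (by simp [hy]))
    have hx := h x (by simp)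
    simp only [List.map_cons, List.prod_cons, List.sum_cons, Nil.mul_v, Nil.mul_B, ih'.1, ih'.2, hx]
    simp

theorem Nil.ev_v {α : Type} [DecidableEq α] (φ : α → Nil ι) (w : Wd α)
    (h : ∀ a, cnt w a = 0 ∨ cnt w a = 2) (i : ι) : (ev φ w).v i = 0 := by
  have h1 : (ev φ w).v i = ((w.map Prod.fst).map (fun a => (φ a).v i)).sum := by
    clear h
    induction w with
    | nil => simp [Nil.one_v]
    | cons l w ih =>
      rw [ev_cons, Nil.mul_v, ih]
      rcases l with ⟨a, s⟩
      cases s <;> simp [evl, Nil.inv_v, zmod2_neg]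
  rw [h1, Finset.sum_list_map_count]
  apply Finset.sum_eq_zero
  intro a _
  rcases h a with h | h
  · rw [cnt] at h; rw [h]; simp
  · rw [cnt] at h; rw [h, two_nsmul, zmod2_add]

/-- trivial length function -/
def LF.triv (H : Type) [Group H] : LF H := ⟨fun _ => 0, rfl, fun _ => rfl, fun _ _ => le_rfl⟩

end
end Stmt8

namespace Stmt8

/-- value of a piece -/
def pv {T H : Type} [Group H] (φ : T → H) (x : H × Bool × Wd T) : H :=
  x.1 * (cond x.2.1 (ev φ x.2.2) (ev φ x.2.2)⁻¹) * x.1⁻¹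

/-- signed solutions -/
def Sol {T : Type} (P : ℕ) (C : List (Wd T)) (Xs : List (FreeGroup T))
    (L : List (FreeGroup T × Bool × Wd T)) : Prop :=
  Xs.length = P ∧ (L.map (fun x => x.2.2)).Perm C ∧ sqp Xs * (L.map (pv FreeGroup.of)).prod = 1

section
variable {T : Type} [DecidableEq T]

theorem zmod2_two : (2 : ZMod 2) = 0 := by decide

theorem ev_flatten {H : Type} [Group H] (φ : T → H) (C : List (Wd T)) :
    ev φ C.flatten = (C.map (ev φ)).prod := by
  induction C with
  | nil => simp
  | cons c C ih => simp [ih]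

theorem Red_univ {w : Wd T} {p q : ℕ} {C : List (Wd T)} {c₀ : Wd T} (h : Red Set.univ w p q C c₀)
    {H : Type} [Group H] (φ : T → H) (Xs : List H) (UVs : List (H × H)) (ws : List H) :
    NF φ Xs UVs ws C c₀ = sqp Xs * cmp UVs := by
  obtain ⟨h1, h2, -⟩ := h
  have hc : c₀ = [] := by
    rcases c₀ with _ | ⟨l, c⟩
    · rfl
    · exact absurd (Set.mem_univ _) (h2 l (by simp))
  subst hc
  have : (List.zipWith (fun w c => w * ev φ c * w⁻¹) ws C).prod = 1 := by
    clear h2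
    induction ws generalizing C with
    | nil => simp
    | cons x ws ih =>
      rcases C with _ | ⟨c, C⟩
      · simp
      · have hc : c = [] := by
          rcases c with _ | ⟨l, c⟩
          · rfl
          · exact absurd (Set.mem_univ _) (h1 (l :: c) (by simp) l (by simp))
        subst hc
        rw [List.zipWith_cons_cons, List.prod_cons, ih (fun c hc => h1 c (by simp [hc]))]
        simp
  rw [NF, this]
  simp [sqp, cmp]

theorem LB {w : Wd T} {p q : ℕ} {C : List (Wd T)} {c₀ : Wd T} (h : Red Set.univ w p q C c₀)
    (C0 : List (Wd T)) (hC0 : C0.flatten = w) (hev : ∀ c ∈ C0, ∀ a, cnt c a = 0 ∨ cnt c a = 2)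
    {P : ℕ} {Xs : List (FreeGroup T)} {L : List (FreeGroup T × Bool × Wd T)} (hs : Sol P C0 Xs L) :
    p + 2 * q ≤ P ∧ (p = 0 → 1 ≤ P → 2 * q + 1 ≤ P) := by
  have hU := fun φ Xs UVs ws => Red_univ h (H := Nil (Ix p q)) φ Xs UVs ws
  obtain ⟨-, -, -, -, -, h6⟩ := h
  obtain ⟨-, h8⟩ := h6 (Nil (Ix p q)) (LF.triv _)
  obtain ⟨φ, -, hφ, -⟩ := h8 (fun _ => 1) 0 0 (fun _ _ _ => le_rfl)
    (List.ofFn (fun i : Fin p => (⟨Pi.single (Sum.inl i) 1, 0⟩ : Nil (Ix p q))))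
    (List.ofFn (fun j : Fin q => ((⟨Pi.single (Sum.inr (j, true)) 1, 0⟩ : Nil (Ix p q)),
      (⟨Pi.single (Sum.inr (j, false)) 1, 0⟩ : Nil (Ix p q)))))
    (List.replicate C.length 1) (by simp) (by simp) (by simp)
    ⟨fun _ _ => le_rfl, fun _ _ => ⟨le_rfl, le_rfl⟩, fun _ _ => le_rfl⟩
  rw [hU] at hφ
  have hM : ∀ a b, (ev φ w).B a b = if sg a = b then 1 else 0 := by
    intro a b
    rw [hφ, Nil.mul_B, sqp, cmp]
    have s1 := Nil.prod_B (List.ofFn (fun i : Fin p => (⟨Pi.single (Sum.inl i) 1, 0⟩ : Nil (Ix p q))))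
      (fun x => x * x) (by intro x _ a; rw [Nil.mul_v, zmod2_add]) a b
    have s2 := Nil.prod_B (List.ofFn (fun j : Fin q => ((⟨Pi.single (Sum.inr (j, true)) 1, 0⟩ : Nil (Ix p q)),
      (⟨Pi.single (Sum.inr (j, false)) 1, 0⟩ : Nil (Ix p q)))))
      (fun u => u.1 * u.2 * u.1⁻¹ * u.2⁻¹) (by
        intro x _ a; simp only [Nil.mul_v, Nil.inv_v]; ring) a b
    rw [s1.1, s1.2, s2.2]
    simp only [List.map_ofFn, List.sum_ofFn, Function.comp_def, Nil.mul_B, Nil.inv_B, Nil.mul_v,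
      Nil.inv_v]
    rcases a with i | ⟨j, s⟩ <;> rcases b with i' | ⟨j', s'⟩
    · simp [Pi.single_apply, sg, Finset.sum_ite_eq, eq_comm]
    · simp [Pi.single_apply, sg]
    · simp [Pi.single_apply, sg]
    · cases s <;> cases s' <;> simp [Pi.single_apply, sg, eq_comm, zmod2_neg, zmod2_add]
  obtain ⟨g1, g2, g3⟩ := hs
  have key := LA p q (Xs.map (fun X => (FreeGroup.lift φ X).v)) (by
    intro a b
    have e := congrArg (FreeGroup.lift φ) g3
    rw [map_mul, map_one, sqp, map_list_prod, map_list_prod, List.map_map, List.map_map] at e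
    have s1 := Nil.prod_B Xs (FreeGroup.lift φ ∘ (fun x => x * x)) (by
      intro x _ a; simp only [Function.comp_apply, map_mul, Nil.mul_v]; rw [zmod2_add]) a b
    have hc : ∀ x ∈ L, ∀ a, (ev φ x.2.2).v a = 0 := by
      intro x hx a
      apply Nil.ev_v
      apply hev
      exact g2.subset (List.mem_map_of_mem hx)
    have hof : ∀ x : FreeGroup T × Bool × Wd T, FreeGroup.lift φ (pv FreeGroup.of x) =
        (FreeGroup.lift φ x.1) * (cond x.2.1 (ev φ x.2.2) (ev φ x.2.2)⁻¹) *
          (FreeGroup.lift φ x.1)⁻¹ := by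
      intro x
      have : FreeGroup.lift φ (ev FreeGroup.of x.2.2) = ev φ x.2.2 := by
        rw [ev_hom]; simp
      unfold pv
      rw [map_mul, map_mul, map_inv]
      cases x.2.1 <;> simp [this]
    have hB : ∀ x ∈ L, ∀ a b, (FreeGroup.lift φ (pv FreeGroup.of x)).v a = 0 ∧
        (FreeGroup.lift φ (pv FreeGroup.of x)).B a b = (ev φ x.2.2).B a b := by
      intro x hx a b
      rw [hof]
      cases x.2.1 <;> simp only [cond_true, cond_false, Nil.mul_v, Nil.mul_B, Nil.inv_v, Nil.inv_B,
        hc x hx] <;> simp [zmod2_neg, zmod2_add] <;> ring_nf <;>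
        simp [zmod2_two]
    have s2 := Nil.prod_B L (FreeGroup.lift φ ∘ pv FreeGroup.of)
      (fun x hx a => (hB x hx a a).1) a b
    have e' := congrArg (fun z : Nil (Ix p q) => z.B a b) e
    simp only [Nil.mul_B, s1.1, s1.2, s2.2, Nil.one_B] at e'
    have e2 : (L.map (fun x => ((FreeGroup.lift φ ∘ pv FreeGroup.of) x).B a b)).sum =
        (ev φ w).B a b := by
      rw [← hC0, ev_flatten, (Nil.prod_B C0 (ev φ) (fun c hc a => Nil.ev_v _ _ (hev c hc) a) a b).2]
      rw [← (g2.map (fun c => (ev φ c).B a b)).sum_eq, List.map_map]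
      congr 1
      apply List.map_congr_left
      intro x hx
      exact (hB x hx a b).2
    rw [e2, hM] at e'
    rw [List.map_map]
    have e3 : (Xs.map (fun x => ((FreeGroup.lift φ ∘ fun x => x * x) x).B a b)) =
      (Xs.map ((fun v => v a * v b) ∘ fun X => (FreeGroup.lift φ X).v)) := by
      apply List.map_congr_left
      intro x _
      simp only [Function.comp_apply, map_mul, Nil.mul_B, zmod2_add, zero_add]
    rw [e3] at e'
    rw [zero_mul, add_zero] at e'
    rw [eq_neg_of_add_eq_zero_left e', zmod2_neg])
  simpa [g1] using key

end
end Stmt8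

namespace Stmt8

/-- word norm as length function -/
def LFn (T : Type) [DecidableEq T] : LF (FreeGroup T) :=
  ⟨FreeGroup.norm, FreeGroup.norm_one, fun _ => FreeGroup.norm_inv_eq, fun _ _ => FreeGroup.norm_mul_le _ _⟩

section
variable {T : Type} [DecidableEq T]

theorem split_map_perm {β γ : Type} {f : β → γ} {L : List β} {c : γ} {C : List γ}
    (h : (L.map f).Perm (c :: C)) :
    ∃ L1 y L2, L = L1 ++ y :: L2 ∧ f y = c ∧ ((L1 ++ L2).map f).Perm C := by
  have hc : c ∈ L.map f := h.mem_iff.2 (by simp)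
  obtain ⟨y, hy, rfl⟩ := List.mem_map.1 hc
  obtain ⟨L1, L2, rfl⟩ := List.append_of_mem hy
  refine ⟨L1, y, L2, rfl, rfl, ?_⟩
  rw [List.map_append, List.map_cons] at h
  rw [List.map_append]
  exact (List.perm_cons (f y)).1 (List.perm_middle.symm.trans h)

theorem norm_ev_of (w : Wd T) : (LFn T).ℓ (ev FreeGroup.of w) ≤ w.length := by
  have := (LFn T).ev FreeGroup.of w 1 (by intro l _; simp [LFn])
  simpa using this

theorem Sol.perm {P : ℕ} {C C' : List (Wd T)} {Xs L} (h : Sol P C Xs L) (e : C.Perm C') :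
    Sol P C' Xs L := ⟨h.1, h.2.1.trans e, h.2.2⟩

theorem Sol.flip {P : ℕ} {c : Wd T} {C : List (Wd T)} {Xs L} (h : Sol P (c :: C) Xs L) :
    ∃ L', Sol P (FreeGroup.invRev c :: C) Xs L' ∧ ∀ y ∈ L', ∃ z ∈ L, z.1 = y.1 := by
  obtain ⟨h1, h2, h3⟩ := h
  obtain ⟨L1, ⟨g, s, c⟩, L2, rfl, rfl, h4⟩ := split_map_perm h2
  refine ⟨L1 ++ (g, !s, FreeGroup.invRev c) :: L2, ⟨h1, ?_, ?_⟩, ?_⟩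
  · rw [List.map_append, List.map_cons]
    refine List.perm_middle.trans ?_
    rw [← List.map_append]
    exact h4.cons _
  · have : pv FreeGroup.of (g, !s, FreeGroup.invRev c) = pv FreeGroup.of (g, s, c) := by
      cases s <;> simp [pv]
    simpa [this] using h3
  · intro y hy
    simp only [List.mem_append, List.mem_cons] at hy
    rcases hy with hy | rfl | hy
    · exact ⟨y, by simp [hy], rfl⟩
    · exact ⟨(g, s, c), by simp, rfl⟩
    · exact ⟨y, by simp [hy], rfl⟩

theorem Sol.back {P : ℕ} {t : T} {δ : Bool} {a1 b1 a2 b2 : Wd T} {R : List (Wd T)} {Xs L} {n m : ℕ}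
    (h : Sol P ((b1 ++ (a1 ++ (b2 ++ a2))) :: R) Xs L) (hm : ∀ y ∈ L, (LFn T).ℓ y.1 ≤ m)
    (hb1 : b1.length ≤ n) (ha2 : a2.length ≤ n) :
    ∃ L', Sol P ((a1 ++ (t, δ) :: b1) :: (a2 ++ (t, !δ) :: b2) :: R) Xs L' ∧
      ∀ y ∈ L', (LFn T).ℓ y.1 ≤ m + n := by
  obtain ⟨h1, h2, h3⟩ := h
  obtain ⟨L1, ⟨g, s, c⟩, L2, rfl, hc, h4⟩ := split_map_perm h2
  simp only at hc
  subst hc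
  have hg : (LFn T).ℓ g ≤ m := hm (g, s, _) (List.mem_append_right _ List.mem_cons_self)
  have n1 := (LFn T).mul g (ev FreeGroup.of b1)
  have n2 := (LFn T).mul g (ev FreeGroup.of a2)⁻¹
  rw [LF.inv] at n2
  have n3 := norm_ev_of b1
  have n4 := norm_ev_of a2
  cases s
  · refine ⟨L1 ++ (g * (ev FreeGroup.of a2)⁻¹, false, (a2 ++ (t, !δ) :: b2)) ::
      (g * ev FreeGroup.of b1, false, (a1 ++ (t, δ) :: b1)) :: L2, ⟨h1, ?_, ?_⟩, ?_⟩
    · rw [List.map_append, List.map_cons, List.map_cons]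
      refine List.perm_middle.trans ?_
      refine (List.perm_middle.cons _).trans ?_
      rw [← List.map_append]
      exact (List.Perm.swap _ _ _).trans ((h4.cons _).cons _)
    · rw [← h3]
      simp only [List.map_append, List.map_cons, List.prod_append, List.prod_cons, mul_assoc]
      congr 2
      rw [← mul_assoc]
      congr 1
      simp only [pv, ev_append, ev_cons, evl_not, cond_false]
      group
    · intro y hy
      simp only [List.mem_append, List.mem_cons] at hy
      rcases hy with hy | rfl | rfl | hy
      · exact (hm y (by simp [hy])).trans (by omega)
      · simp only; omega
      · simp only; omega
      · exact (hm y (by simp [hy])).trans (by omega)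
  · refine ⟨L1 ++ (g * ev FreeGroup.of b1, true, (a1 ++ (t, δ) :: b1)) ::
      (g * (ev FreeGroup.of a2)⁻¹, true, (a2 ++ (t, !δ) :: b2)) :: L2, ⟨h1, ?_, ?_⟩, ?_⟩
    · rw [List.map_append, List.map_cons, List.map_cons]
      refine List.perm_middle.trans ?_
      refine (List.perm_middle.cons _).trans ?_
      rw [← List.map_append]
      exact (h4.cons _).cons _
    · rw [← h3]
      simp only [List.map_append, List.map_cons, List.prod_append, List.prod_cons, mul_assoc]
      congr 2
      rw [← mul_assoc]
      congr 1
      simp only [pv, ev_append, ev_cons, evl_not, cond_true]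
      group
    · intro y hy
      simp only [List.mem_append, List.mem_cons] at hy
      rcases hy with hy | rfl | rfl | hy
      · exact (hm y (by simp [hy])).trans (by omega)
      · simp only; omega
      · simp only; omega
      · exact (hm y (by simp [hy])).trans (by omega)

theorem Sol.forw {P : ℕ} {t : T} {δ : Bool} {a1 b1 a2 b2 : Wd T} {R : List (Wd T)} {Xs L}
    (h : Sol P ((a1 ++ (t, δ) :: b1) :: (a2 ++ (t, !δ) :: b2) :: R) Xs L)
    (ha1 : cnt a1 t = 0) (hb1 : cnt b1 t = 0) (ha2 : cnt a2 t = 0) (hb2 : cnt b2 t = 0)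
    (hR : ∀ c ∈ R, cnt c t = 0) :
    ∃ Xs' L', Sol P ((b1 ++ (a1 ++ (b2 ++ a2))) :: R) Xs' L' := by
  obtain ⟨h1, h2, h3⟩ := h
  obtain ⟨L1, ⟨g, s, c⟩, L2, rfl, hc, h4⟩ := split_map_perm h2
  simp only at hc
  subst hc
  obtain ⟨M1, ⟨g', s', c⟩, M2, hL, hc, h5⟩ := split_map_perm h4
  simp only at hc
  subst hc
  obtain ⟨v, hv⟩ := exists_evl (FreeGroup.of : T → FreeGroup T) t δ
    (ev FreeGroup.of (b1 ++ a1))⁻¹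
  set ψ := Function.update FreeGroup.of t v with hψ
  have upd : ∀ w : Wd T, cnt w t = 0 → ev ψ w = ev FreeGroup.of w := fun w hw => ev_update _ _ _ hw
  set f := FreeGroup.lift ψ with hf
  have hfe : ∀ w, f (ev FreeGroup.of w) = ev ψ w := by
    intro w; rw [ev_hom]; simp [hf]
  have hfp : ∀ x : FreeGroup T × Bool × Wd T, f (pv FreeGroup.of x) = pv ψ (f x.1, x.2) := by
    rintro ⟨g, s, c⟩
    cases s <;> simp [pv, hfe]
  have key := congrArg f h3
  rw [map_mul, map_one, sqp, map_list_prod, map_list_prod, List.map_map, List.map_map,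
    List.map_append, List.map_cons, List.prod_append, List.prod_cons] at key
  have k1 : (f ∘ pv FreeGroup.of) (g, s, a1 ++ (t, δ) :: b1) = 1 := by
    rw [Function.comp_apply, hfp]
    have : ev ψ (a1 ++ (t, δ) :: b1) = 1 := by
      simp only [ev_append, ev_cons, upd _ ha1, upd _ hb1, hv]
      group
    cases s <;> simp [pv, this]
  rw [k1, one_mul, ← List.prod_append, ← List.map_append, hL, List.map_append, List.map_cons,
    List.prod_append, List.prod_cons] at key
  have k2 : (f ∘ pv FreeGroup.of) (g', s', a2 ++ (t, !δ) :: b2) =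
      pv FreeGroup.of (f g' * ev FreeGroup.of a2, s', b1 ++ (a1 ++ (b2 ++ a2))) := by
    rw [Function.comp_apply, hfp]
    cases s' <;>
    · simp only [pv, cond_true, cond_false, ev_append, ev_cons, upd _ ha2, upd _ hb2, evl_not, hv]
      group
  have hM : ∀ M : List (FreeGroup T × Bool × Wd T), (∀ y ∈ M, y ∈ M1 ++ M2) →
      M.map (f ∘ pv FreeGroup.of) = (M.map (fun y => (f y.1, y.2))).map (pv FreeGroup.of) := by
    intro M hM
    rw [List.map_map]
    apply List.map_congr_left
    intro y hy
    have : cnt y.2.2 t = 0 := hR _ (h5.subset (List.mem_map_of_mem (hM y hy)))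
    rw [Function.comp_apply, Function.comp_apply, hfp]
    simp only [pv, upd _ this]
  rw [k2, hM M1 (by intro y hy; simp [hy]), hM M2 (by intro y hy; simp [hy])] at key
  refine ⟨Xs.map f, M1.map (fun y => (f y.1, y.2)) ++
    (f g' * ev FreeGroup.of a2, s', b1 ++ (a1 ++ (b2 ++ a2))) :: M2.map (fun y => (f y.1, y.2)),
    by simpa using h1, ?_, ?_⟩
  · rw [List.map_append, List.map_cons, List.map_map, List.map_map]
    refine List.perm_middle.trans ?_
    refine List.Perm.cons _ ?_
    rw [List.map_append] at h5
    exact h5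
  · rw [List.map_append, List.map_cons, List.prod_append, List.prod_cons, ← key, sqp, List.map_map]
    congr 3
    funext x
    simp

end
end Stmt8

namespace Stmt8
section
variable {T : Type} [DecidableEq T]

theorem sqp_inv {H : Type} [Group H] (Ys : List H) :
    sqp ((Ys.map (fun y => y⁻¹)).reverse) = (sqp Ys)⁻¹ := by
  induction Ys with
  | nil => simp
  | cons y Ys ih => simp [ih]

theorem sqp_rep {H : Type} [Group H] (n : ℕ) : sqp (List.replicate n (1 : H)) = 1 := by
  simp [sqp]

theorem TM_base {n P : ℕ} (hP : 1 ≤ P) (C : List (Wd T)) (hn : C.flatten.length ≤ n)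
    (hev : ∀ c ∈ C, ∀ a, cnt c a = 0 ∨ cnt c a = 2)
    (h2 : ∀ a, cnt C.flatten a = 0 ∨ cnt C.flatten a = 2)
    {Xs L} (hs : Sol P C Xs L) :
    ∃ Xs L, Sol P C Xs L ∧ (∀ x ∈ Xs, (LFn T).ℓ x ≤ 3 * n * (9 * n + 8)) ∧
      (∀ y ∈ L, (LFn T).ℓ y.1 ≤ 0) := by
  obtain ⟨p, q, C1, c₀, hR, -⟩ := XN Set.univ C.flatten (fun x _ => h2 x)
  obtain ⟨l1, l2⟩ := LB hR C rfl hev hs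
  have hU := fun Xs UVs ws => Red_univ hR (H := FreeGroup T) FreeGroup.of Xs UVs ws
  obtain ⟨-, -, -, -, h5, h6⟩ := hR
  obtain ⟨h7, -⟩ := h6 (FreeGroup T) (LFn T)
  obtain ⟨Xs, UVs, ws, e1, e2, e3, e4, e5⟩ := h7 FreeGroup.of 1 (by intro l _; simp [LFn])
  rw [hU] at e5
  have hq : q ≤ n := by omega
  have hW : 3 * C.flatten.length * 1 * (9 * UVs.length + 8) ≤ 3 * n * (9 * n + 8) := by
    rw [e2]
    refine Nat.mul_le_mul ?_ ?_ <;> omega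
  have : ∃ Ys : List (FreeGroup T), Ys.length ≤ P ∧ ev FreeGroup.of C.flatten = sqp Ys ∧
      ∀ y ∈ Ys, (LFn T).ℓ y ≤ 3 * n * (9 * n + 8) := by
    by_cases hp : p = 0
    · obtain ⟨Ys, f1, f2, f3⟩ := convA (LFn T) (3 * C.flatten.length * 1) 1 [1] UVs le_rfl rfl
        (by simp [LF.one]) e4.2.1
      refine ⟨Ys, ?_, ?_, fun y hy => (f3 y hy).trans hW⟩
      · have := l2 hp hP
        omega
      · have : Xs = [] := by
          apply List.eq_nil_of_length_eq_zero
          omega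
        rw [← f2, e5, this]
        simp
    · obtain ⟨Ys, f1, f2, f3⟩ := convA (LFn T) (3 * C.flatten.length * 1) p Xs UVs (by omega) e1
        e4.1 e4.2.1
      exact ⟨Ys, by omega, by rw [← f2, e5], fun y hy => (f3 y hy).trans hW⟩
  obtain ⟨Ys, y1, y2, y3⟩ := this
  refine ⟨(Ys.map (fun y => y⁻¹)).reverse ++ List.replicate (P - Ys.length) 1,
    C.map (fun c => (1, true, c)), ⟨?_, ?_, ?_⟩, ?_, ?_⟩
  · simp; omega
  · simp [Function.comp_def]
  · rw [sqp_append, sqp_inv, sqp_rep, ← y2, ev_flatten, List.map_map]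
    have : pv FreeGroup.of ∘ (fun c : Wd T => ((1 : FreeGroup T), true, c)) = ev FreeGroup.of := by
      funext c
      simp [pv]
    rw [this]
    simp
  · intro x hx
    simp only [List.mem_append, List.mem_reverse, List.mem_map, List.mem_replicate] at hx
    rcases hx with ⟨y, hy, rfl⟩ | ⟨_, rfl⟩
    · rw [LF.inv]; exact y3 y hy
    · rw [LF.one]; omega
  · intro y hy
    simp only [List.mem_map] at hy
    obtain ⟨c, _, rfl⟩ := hy
    simp [LF.one]

theorem bool_of_ne_not {s1 s2 : Bool} (h : ¬ s2 = !s1) : s2 = s1 := by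
  revert s1 s2; decide

theorem cnt_perm {w w' : Wd T} (h : w.Perm w') (a : T) : cnt w a = cnt w' a :=
  (h.map Prod.fst).count_eq a

theorem cnt_flatten_le {C : List (Wd T)} {c : Wd T} (h : c ∈ C) (a : T) :
    cnt c a ≤ cnt C.flatten a := by
  rw [cnt_perm (List.perm_cons_erase h).flatten a]
  simp

theorem TM {n P : ℕ} (hP : 1 ≤ P) (m : ℕ) : ∀ (C : List (Wd T)), C.length = m →
    C.flatten.length ≤ n →
    (∀ a, cnt C.flatten a = 0 ∨ cnt C.flatten a = 2) →
    ∀ {Xs L}, Sol P C Xs L →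
    ∃ Xs L, Sol P C Xs L ∧ (∀ x ∈ Xs, (LFn T).ℓ x ≤ 3 * n * (9 * n + 8)) ∧
      (∀ y ∈ L, (LFn T).ℓ y.1 ≤ m * n) := by
  induction m with
  | zero =>
    intro C hC hn h2 Xs L hs
    have : C = [] := List.eq_nil_of_length_eq_zero hC
    subst this
    simpa using TM_base hP [] hn (by simp) h2 hs
  | succ m ih =>
    intro C hC hn h2 Xs L hs
    by_cases hev : ∀ c ∈ C, ∀ a, cnt c a = 0 ∨ cnt c a = 2
    · obtain ⟨Xs, L, a1, a2, a3⟩ := TM_base hP C hn hev h2 hs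
      exact ⟨Xs, L, a1, a2, fun y hy => (a3 y hy).trans (Nat.zero_le _)⟩
    -- step for opposite signs
    have step : ∀ (t : T) (δ : Bool) (a1 b1 a2 b2 : Wd T) (R : List (Wd T)) Xs L,
        Sol P ((a1 ++ (t, δ) :: b1) :: (a2 ++ (t, !δ) :: b2) :: R) Xs L →
        R.length + 1 = m → ((a1 ++ (t, δ) :: b1) :: (a2 ++ (t, !δ) :: b2) :: R).flatten.length ≤ n →
        (∀ a, cnt ((a1 ++ (t, δ) :: b1) :: (a2 ++ (t, !δ) :: b2) :: R).flatten a = 0 ∨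
          cnt ((a1 ++ (t, δ) :: b1) :: (a2 ++ (t, !δ) :: b2) :: R).flatten a = 2) →
        ∃ Xs L, Sol P ((a1 ++ (t, δ) :: b1) :: (a2 ++ (t, !δ) :: b2) :: R) Xs L ∧
        (∀ x ∈ Xs, (LFn T).ℓ x ≤ 3 * n * (9 * n + 8)) ∧
        (∀ y ∈ L, (LFn T).ℓ y.1 ≤ (m + 1) * n) := by
      intro t δ a1 b1 a2 b2 R Xs L hs hR hn h2
      have ht := h2 t
      simp at ht
      have hRt : ∀ c ∈ R, cnt c t = 0 := by
        intro c hc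
        have := cnt_flatten_le hc t
        omega
      obtain ⟨Xs', L', hs'⟩ := hs.forw (by omega) (by omega) (by omega) (by omega) hRt
      simp only [List.flatten_cons, List.length_append, List.length_cons] at hn
      obtain ⟨Xs, L, f1, f2, f3⟩ := ih _ (by simp [hR]) (by
        simp only [List.flatten_cons, List.length_append]; omega) (by
        intro a
        have := h2 a
        by_cases hta : t = a
        · subst hta
          left
          simp only [List.flatten_cons, cnt_append]
          omega
        · simp [hta] at this ⊢
          omega) hs'
      obtain ⟨L', g1, g2⟩ := f1.back (t := t) (δ := δ) (n := n) f3 (by omega) (by omega)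
      exact ⟨Xs, L', g1, f2, fun y hy => (g2 y hy).trans (by rw [Nat.add_mul]; omega)⟩
    push Not at hev
    obtain ⟨c1, hc1, t, ht0, ht2⟩ := hev
    have p1 := List.perm_cons_erase hc1
    set R1 := C.erase c1 with hR1
    clear_value R1
    have k1 := cnt_flatten_le hc1 t
    have k2 := cnt_perm p1.flatten t
    simp only [List.flatten_cons, cnt_append] at k2
    have k3 := h2 t
    have k4 : 0 < cnt R1.flatten t := by omega
    obtain ⟨l, hl, hlt⟩ := cnt_pos.1 k4
    obtain ⟨c2, hc2, hlc⟩ := List.mem_flatten.1 hl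
    have k5 : 0 < cnt c2 t := cnt_pos.2 ⟨l, hlc, hlt⟩
    have p2 := List.perm_cons_erase hc2
    set R := R1.erase c2 with hR
    clear_value R
    have p3 : C.Perm (c1 :: c2 :: R) := p1.trans (p2.cons _)
    have k6 := cnt_perm p2.flatten t
    simp only [List.flatten_cons, cnt_append] at k6
    have hlen : R.length + 1 = m := by
      have := p3.length_eq
      simp at this
      omega
    have hn' : (c1 :: c2 :: R).flatten.length ≤ n := by
      rw [← p3.flatten.length_eq]; exact hn
    have h2' : ∀ a, cnt (c1 :: c2 :: R).flatten a = 0 ∨ cnt (c1 :: c2 :: R).flatten a = 2 := by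
      intro a
      rw [← cnt_perm p3.flatten a]; exact h2 a
    have hs' := hs.perm p3
    suffices h : ∃ Xs L, Sol P (c1 :: c2 :: R) Xs L ∧
        (∀ x ∈ Xs, (LFn T).ℓ x ≤ 3 * n * (9 * n + 8)) ∧
        (∀ y ∈ L, (LFn T).ℓ y.1 ≤ (m + 1) * n) by
      obtain ⟨Xs, L, a1, a2, a3⟩ := h
      exact ⟨Xs, L, a1.perm p3.symm, a2, a3⟩
    obtain ⟨a1, s1, b1, e1, -⟩ := split_of_cnt_pos (w := c1) (a := t) (by omega)
    obtain ⟨a2, s2, b2, e2, -⟩ := split_of_cnt_pos (w := c2) (a := t) (by omega)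
    by_cases hss : s2 = !s1
    · subst hss e1 e2
      exact step t s1 a1 b1 a2 b2 R Xs L hs' hlen hn' h2'
    · have : s2 = s1 := by
        exact bool_of_ne_not hss
      subst this
      obtain ⟨L', hs'', -⟩ := (hs'.perm (List.Perm.swap _ _ _)).flip
      replace hs'' := hs''.perm (List.Perm.swap _ _ _)
      have ei : FreeGroup.invRev c2 = FreeGroup.invRev b2 ++ (t, !s2) :: FreeGroup.invRev a2 := by
        rw [e2, FreeGroup.invRev_append]
        simp [FreeGroup.invRev]
      have hs3 := hs''
      rw [ei, e1] at hs3
      obtain ⟨Xs, L, f1, f2, f3⟩ := step t s2 a1 b1 _ _ R Xs L' hs3 hlen (by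
        rw [← ei, ← e1]
        simp only [List.flatten_cons, List.length_append, FreeGroup.invRev_length] at hn' ⊢
        exact hn') (by
        intro a
        rw [← ei, ← e1]
        have := h2' a
        simp only [List.flatten_cons, cnt_append, cnt_invRev] at this ⊢
        exact this)
      rw [← ei, ← e1] at f1
      obtain ⟨L2, g1, g2⟩ := (f1.perm (List.Perm.swap _ _ _)).flip
      refine ⟨Xs, L2, ?_, f2, ?_⟩
      · rw [FreeGroup.invRev_invRev] at g1
        exact g1.perm (List.Perm.swap _ _ _)
      · intro y hy
        obtain ⟨z, hz, e⟩ := g2 y hy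
        rw [← e]; exact f3 z hz

end
end Stmt8

namespace Stmt8
section
variable {T H : Type} [Group H]

/-- value of an unsigned piece -/
def pw (φ : T → H) (x : H × Wd T) : H := x.1 * ev φ x.2 * x.1⁻¹

theorem conj_bound (L : LF H) {g c : H} {m n : ℕ} (hg : L.ℓ g ≤ m) (hc : L.ℓ c ≤ n) :
    L.ℓ (g * c * g⁻¹) ≤ 2 * m + n := by
  have := L.mul3 g c g⁻¹
  rw [L.inv] at this
  omega

theorem flipL (L : LF H) (φ : T → H) (m n : ℕ) : ∀ (Ps : List (H × Bool × Wd T)) (Y : H) (b : ℕ),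
    (∀ x ∈ Ps, L.ℓ x.1 ≤ m ∧ L.ℓ (ev φ x.2.2) ≤ n) → L.ℓ Y ≤ b →
    ∃ (Y' : H) (Ws : List (H × Wd T)), Ws.map Prod.snd = Ps.map (fun x => x.2.2) ∧
      Y * Y * (Ps.map (pv φ)).prod = (Ws.map (pw φ)).prod * (Y' * Y') ∧
      L.ℓ Y' ≤ b + Ps.length * (2 * m + n) ∧
      ∀ x ∈ Ws, L.ℓ x.1 ≤ 2 * (b + Ps.length * (2 * m + n)) + m := by
  intro Ps
  induction Ps with
  | nil =>
    intro Y b _ hY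
    exact ⟨Y, [], rfl, by simp, by simpa using hY, by simp⟩
  | cons x Ps ih =>
    intro Y b hP hY
    rcases x with ⟨g, s, c⟩
    obtain ⟨hg, hc⟩ := hP (g, s, c) (by simp)
    simp only at hg hc
    have hf := conj_bound L hg hc
    have hlen : b + (Ps.length + 1) * (2 * m + n) = (b + (2 * m + n)) + Ps.length * (2 * m + n) := by
      ring
    simp only [List.length_cons, hlen]
    cases s
    · have hY' : L.ℓ (Y * (g * ev φ c * g⁻¹)⁻¹) ≤ b + (2 * m + n) := by
        have := L.mul Y (g * ev φ c * g⁻¹)⁻¹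
        rw [L.inv] at this
        omega
      obtain ⟨Y', Ws, a1, a2, a3, a4⟩ := ih (Y * (g * ev φ c * g⁻¹)⁻¹) (b + (2 * m + n))
        (fun x hx => hP x (by simp [hx])) hY'
      refine ⟨Y', ((Y * (g * ev φ c * g⁻¹)⁻¹) * g, c) :: Ws, by simp [a1], ?_, a3, ?_⟩
      · simp only [List.map_cons, List.prod_cons]
        rw [mul_assoc (pw φ _), ← a2]
        simp only [pv, pw, cond_false]
        group
      · intro x hx
        rcases List.mem_cons.1 hx with rfl | hx
        · have := L.mul (Y * (g * ev φ c * g⁻¹)⁻¹) g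
          simp only
          omega
        · exact a4 x hx
    · obtain ⟨Y', Ws, a1, a2, a3, a4⟩ := ih Y (b + (2 * m + n))
        (fun x hx => hP x (by simp [hx])) (by omega)
      refine ⟨Y', (Y * Y * g, c) :: Ws, by simp [a1], ?_, a3, ?_⟩
      · simp only [List.map_cons, List.prod_cons]
        rw [mul_assoc (pw φ _), ← a2]
        simp only [pv, pw, cond_true]
        group
      · intro x hx
        rcases List.mem_cons.1 hx with rfl | hx
        · have := L.mul3 Y Y g
          simp only
          omega
        · exact a4 x hx

theorem prod_pw_bound (L : LF H) (φ : T → H) {M n : ℕ} (Ws : List (H × Wd T))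
    (h : ∀ x ∈ Ws, L.ℓ x.1 ≤ M ∧ L.ℓ (ev φ x.2) ≤ n) :
    L.ℓ (Ws.map (pw φ)).prod ≤ Ws.length * (2 * M + n) := by
  induction Ws with
  | nil => simp [L.one]
  | cons x Ws ih =>
    have h1 := ih (fun y hy => h y (by simp [hy]))
    have h2 := h x (by simp)
    have h3 := conj_bound L h2.1 h2.2
    have h4 := L.mul (pw φ x) (Ws.map (pw φ)).prod
    rw [List.map_cons, List.prod_cons, List.length_cons, Nat.add_mul]
    have h3' : L.ℓ (pw φ x) ≤ 2 * M + n := h3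
    omega

theorem reorder (L : LF H) (φ : T → H) (M n k : ℕ) : ∀ (C : List (Wd T)) (Ws : List (H × Wd T)),
    (Ws.map Prod.snd).Perm C → (∀ x ∈ Ws, L.ℓ x.1 ≤ M ∧ L.ℓ (ev φ x.2) ≤ n) → Ws.length ≤ k →
    ∃ ws : List H, ws.length = C.length ∧
      (Ws.map (pw φ)).prod = (List.zipWith (fun w c => w * ev φ c * w⁻¹) ws C).prod ∧
      ∀ x ∈ ws, L.ℓ x ≤ M + k * (2 * M + n) := by
  intro C
  induction C with
  | nil =>
    intro Ws h _ _
    have : Ws = [] := by simpa using h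
    subst this
    exact ⟨[], rfl, by simp, by simp⟩
  | cons c C ih =>
    intro Ws h hM hk
    obtain ⟨L1, ⟨w, c⟩, L2, rfl, rfl, h4⟩ := split_map_perm h
    simp only [List.length_append, List.length_cons] at hk
    obtain ⟨ws, a1, a2, a3⟩ := ih (L1 ++ L2) h4 (fun x hx => hM x (by
      simp only [List.mem_append, List.mem_cons] at hx ⊢; tauto)) (by
      simp only [List.length_append]; omega)
    refine ⟨((L1.map (pw φ)).prod * w) :: ws, by simp [a1], ?_, ?_⟩
    · rw [List.zipWith_cons_cons, List.prod_cons, ← a2]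
      simp only [List.map_append, List.map_cons, List.prod_append, List.prod_cons]
      conv_lhs => rw [pw]
      group
    · intro x hx
      rcases List.mem_cons.1 hx with rfl | hx
      · have b1 := L.mul (L1.map (pw φ)).prod w
        have b2 := prod_pw_bound L φ (M := M) (n := n) L1 (fun x hx => hM x (by simp [hx]))
        have b3 := (hM (w, c) (by simp)).1
        have b4 : L1.length * (2 * M + n) ≤ k * (2 * M + n) :=
          Nat.mul_le_mul_right _ (by omega)
        simp only at b3
        omega
      · exact a3 x hx

theorem sqp_conj (w : H) (Ys : List H) :
    sqp (Ys.map (fun y => w⁻¹ * y * w)) = w⁻¹ * sqp Ys * w := by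
  induction Ys with
  | nil => simp
  | cons y Ys ih => simp only [List.map_cons, sqp_cons, ih]; group

theorem zip_conj (φ : T → H) (w : H) : ∀ (ws : List H) (C : List (Wd T)),
    (List.zipWith (fun w c => w * ev φ c * w⁻¹) (ws.map (fun y => w⁻¹ * y)) C).prod =
      w⁻¹ * (List.zipWith (fun w c => w * ev φ c * w⁻¹) ws C).prod * w := by
  intro ws
  induction ws with
  | nil => simp
  | cons x ws ih =>
    intro C
    rcases C with _ | ⟨c, C⟩
    · simp
    · simp only [List.map_cons, List.zipWith_cons_cons, List.prod_cons, ih]; group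

/-- turn a signed solution into an unsigned ordered one. -/
theorem unsign (L : LF H) (φ : T → H) (a m n k : ℕ) (Xs : List H) (Ps : List (H × Bool × Wd T))
    (C : List (Wd T)) (c₀ : Wd T) (hX : 1 ≤ Xs.length)
    (hC : (Ps.map (fun x => x.2.2)).Perm (C ++ [c₀])) (hk : C.length + 1 ≤ k)
    (he : sqp Xs * (Ps.map (pv φ)).prod = 1)
    (ha : ∀ x ∈ Xs, L.ℓ x ≤ a) (hP : ∀ x ∈ Ps, L.ℓ x.1 ≤ m ∧ L.ℓ (ev φ x.2.2) ≤ n)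
    (M W : ℕ) (hM : 2 * (a + k * (2 * m + n)) + m ≤ M) (hW : 3 * (M + k * (2 * M + n)) ≤ W) :
    ∃ Ys ws : List H, Ys.length = Xs.length ∧ ws.length = C.length ∧
      sqp Ys * (List.zipWith (fun w c => w * ev φ c * w⁻¹) ws C).prod * ev φ c₀ = 1 ∧
      (∀ y ∈ Ys, L.ℓ y ≤ W) ∧ (∀ y ∈ ws, L.ℓ y ≤ W) := by
  obtain ⟨Xs', s, rfl⟩ : ∃ Xs' s, Xs = Xs' ++ [s] := by
    rcases List.eq_nil_or_concat Xs with rfl | ⟨l, b, h⟩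
    · simp at hX
    · exact ⟨l, b, by simpa using h⟩
  have hlen : Ps.length = C.length + 1 := by simpa using hC.length_eq
  have hkm : Ps.length * (2 * m + n) ≤ k * (2 * m + n) := Nat.mul_le_mul_right _ (by omega)
  obtain ⟨Y', Ws, a1, a2, a3, a4⟩ := flipL L φ m n Ps s a hP (ha s (by simp))
  have hWl : Ws.length = C.length + 1 := by
    have := congrArg List.length a1
    simpa [hlen] using this
  have hWs : ∀ x ∈ Ws, L.ℓ x.1 ≤ M ∧ L.ℓ (ev φ x.2) ≤ n := by
    intro x hx
    refine ⟨(a4 x hx).trans (by omega), ?_⟩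
    have : x.2 ∈ Ps.map (fun x => x.2.2) := by
      rw [← a1]; exact List.mem_map_of_mem hx
    obtain ⟨z, hz, e⟩ := List.mem_map.1 this
    rw [← e]; exact (hP z hz).2
  obtain ⟨ws', b1, b2, b3⟩ := reorder L φ M n k (C ++ [c₀]) Ws (by rw [a1]; exact hC) hWs (by omega)
  obtain ⟨ws, w, rfl⟩ : ∃ ws w, ws' = ws ++ [w] := by
    rcases List.eq_nil_or_concat ws' with rfl | ⟨l, b, h⟩
    · simp at b1
    · exact ⟨l, b, by simpa using h⟩
  have hwl : ws.length = C.length := by simpa using b1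
  rw [List.zipWith_append hwl, List.prod_append] at b2
  simp only [List.zipWith_cons_cons, List.zipWith_nil_left, List.prod_cons, List.prod_nil,
    mul_one] at b2
  refine ⟨(Y' :: Xs').map (fun y => w⁻¹ * y * w), ws.map (fun y => w⁻¹ * y), by simp,
    by simp [hwl], ?_, ?_, ?_⟩
  · rw [sqp_conj, zip_conj]
    rw [sqp_append, sqp_cons, sqp_nil, mul_one, mul_assoc, a2, b2] at he
    have he' : (Y' * Y') * (sqp Xs' * ((List.zipWith (fun w c => w * ev φ c * w⁻¹) ws C).prod *
        (w * ev φ c₀ * w⁻¹))) = 1 := by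
      rw [← mul_assoc] at he
      exact mul_eq_one_comm.1 he
    rw [sqp_cons]
    have := congrArg (fun z => w⁻¹ * z * w) he'
    simp only [mul_one, inv_mul_cancel] at this
    rw [← this]
    group
  · have hw := b3 w (by simp)
    intro y hy
    obtain ⟨x, hx, rfl⟩ := List.mem_map.1 hy
    have h1 := L.mul3 w⁻¹ x w
    rw [L.inv] at h1
    have : L.ℓ x ≤ M + k * (2 * M + n) := by
      rcases List.mem_cons.1 hx with rfl | hx
      · omega
      · have := ha x (by simp [hx])
        omega
    omega
  · have hw := b3 w (by simp)
    intro y hy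
    obtain ⟨x, hx, rfl⟩ := List.mem_map.1 hy
    have h1 := L.mul w⁻¹ x
    rw [L.inv] at h1
    have := b3 x (by simp [hx])
    omega

end
end Stmt8

namespace Stmt8
section
variable {α : Type} [DecidableEq α]

theorem ev_flat_one {H : Type} [Group H] (φ : α → H) (ws : List H) (C : List (Wd α)) :
    ((List.zipWith (fun w c => (w, true, c)) ws C).map (pv φ)).prod =
      (List.zipWith (fun w c => w * ev φ c * w⁻¹) ws C).prod := by
  rw [List.map_zipWith]
  rfl

theorem MG (S : Set α) (w : Wd α) (hS : ∀ a, cnt w a = 0 ∨ cnt w a = 2)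
    (hno : ∃ x ∈ S, ∃ s, w.count (x, s) = 2) (φ : α → FreeGroup α)
    (hφ : ∀ a, a ∉ S → φ a = FreeGroup.of a) (he : ev φ w = 1) :
    ∃ φ' : α → FreeGroup α, (∀ a, a ∉ S → φ' a = FreeGroup.of a) ∧ ev φ' w = 1 ∧
      ∀ x, 0 < cnt w x → (φ' x).norm ≤ 32002 * w.length ^ 6 := by
  obtain ⟨p, q, C, c₀, ⟨h1, h2, h3, h4, h5, h6⟩, hp⟩ := XN S w (fun x _ => hS x)
  have hp := hp hno
  obtain ⟨n, hn⟩ : ∃ n, n = w.length := ⟨_, rfl⟩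
  rw [← hn] at h4 h5 ⊢
  have hn1 : 1 ≤ n := by omega
  -- extract a solution of the normal form
  obtain ⟨h7, -⟩ := h6 (FreeGroup α) (LF.triv _)
  obtain ⟨Xs, UVs, ws, a1, a2, a3, -, a5⟩ := h7 φ 0 (fun _ _ => le_rfl)
  rw [he] at a5
  have e1 : ∀ c : Wd α, (∀ l ∈ c, l.1 ∉ S) → ev φ c = ev FreeGroup.of c :=
    fun c hc => ev_congr (fun l hl => hφ _ (hc l hl))
  have e2 : ∀ (D : List (Wd α)) (ws : List (FreeGroup α)), (∀ c ∈ D, ∀ l ∈ c, l.1 ∉ S) →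
      List.zipWith (fun w c => w * ev φ c * w⁻¹) ws D =
      List.zipWith (fun w c => w * ev FreeGroup.of c * w⁻¹) ws D := by
    intro D
    induction D with
    | nil => simp
    | cons c D ih =>
      intro ws hD
      rcases ws with _ | ⟨w, ws⟩
      · simp
      · rw [List.zipWith_cons_cons, List.zipWith_cons_cons, ih _ (fun c hc => hD c (by simp [hc])),
          e1 c (hD c (by simp))]
  obtain ⟨Ys, b1, b2, -⟩ := convA (LF.triv (FreeGroup α)) 0 p Xs UVs hp a1 (fun _ _ => le_rfl)
    (fun _ _ => ⟨le_rfl, le_rfl⟩)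
  have hsol : Sol (p + 2 * q) (C ++ [c₀]) Ys
      (List.zipWith (fun w c => (w, true, c)) ws C ++ [((1 : FreeGroup α), true, c₀)]) := by
    refine ⟨by rw [b1, a2], ?_, ?_⟩
    · have : List.map (fun x : FreeGroup α × Bool × Wd α => x.2.2)
          (List.zipWith (fun w c => (w, true, c)) ws C) = C := by
        rw [List.map_zipWith]
        clear a5 e2 h1 h3 h4 h5 h6 h7
        induction C generalizing ws with
        | nil => simp
        | cons c C ih =>
          rcases ws with _ | ⟨w, ws⟩
          · simp at a3
          · simp only [List.zipWith_cons_cons]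
            rw [ih ws (by simpa using a3)]
      rw [List.map_append, this]
      exact List.Perm.refl _
    · rw [List.map_append, List.prod_append, ev_flat_one, ← b2, ← e2 C ws h1]
      rw [NF, e1 c₀ h2] at a5
      simp only [List.map_cons, List.map_nil, List.prod_cons, List.prod_nil, mul_one, pv,
        cond_true, one_mul, inv_one]
      rw [a5, sqp, cmp]
      group
  have hlen : (C ++ [c₀]).flatten.length ≤ n := by
    simpa using h4
  obtain ⟨Xs1, L1, ⟨c1, c2, c3⟩, c4, c5⟩ := TM (n := n) (P := p + 2 * q) (by omega) (C.length + 1)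
    (C ++ [c₀]) (by simp) hlen (by
      intro a
      have e : (C ++ [c₀]).flatten = C.flatten ++ c₀ := by simp
      rw [e]
      by_cases ha : a ∈ S
      · left
        rw [cnt_eq_zero]
        intro l hl
        have : l.1 ∉ S := by
          rcases List.mem_append.1 hl with hl | hl
          · obtain ⟨c, hc, hl⟩ := List.mem_flatten.1 hl
            exact h1 c hc l hl
          · exact h2 l hl
        exact fun e => this (e ▸ ha)
      · rw [h3 a ha]; exact hS a) hsol
  have hq : q + 1 ≤ n := by omega
  have hCn : C.length + 1 ≤ n := by omega
  have p2 : n ≤ n ^ 2 := Nat.le_self_pow (by omega) n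
  have p3 : n ^ 2 ≤ n ^ 3 := Nat.pow_le_pow_right hn1 (by omega)
  have p4 : n ^ 3 ≤ n ^ 4 := Nat.pow_le_pow_right hn1 (by omega)
  have p6 : n ≤ n ^ 6 := Nat.le_self_pow (by omega) n
  obtain ⟨Ys2, ws2, d1, d2, d3, d4, d5⟩ := unsign (LFn α) FreeGroup.of (51 * n ^ 2) (n ^ 2) n n
    Xs1 L1 C c₀ (by omega) c2 hCn c3 (fun x hx => (c4 x hx).trans (by nlinarith)) (by
      intro x hx
      refine ⟨(c5 x hx).trans (by nlinarith), (norm_ev_of _).trans ?_⟩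
      have : x.2.2 ∈ C ++ [c₀] := c2.subset (List.mem_map.2 ⟨x, hx, rfl⟩)
      refine le_trans ?_ hlen
      obtain ⟨s, t, e⟩ := List.append_of_mem this
      rw [e]
      simp only [List.flatten_append, List.flatten_cons, List.length_append]
      omega) (109 * n ^ 3) (1000 * n ^ 4) (by
        have : n * (2 * n ^ 2 + n) = 2 * n ^ 3 + n ^ 2 := by ring
        rw [this]; omega) (by
        have : n * (2 * (109 * n ^ 3) + n) = 218 * n ^ 4 + n ^ 2 := by ring
        rw [this]; omega)
  obtain ⟨Xs3, UVs3, f1, f2, f3, f4, f5⟩ := convB (LFn α) (1000 * n ^ 4) p q Ys2 hp (by omega) d4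
  have hB : 1000 * n ^ 4 * (8 * q + 8) ≤ 8000 * n ^ 5 := by
    have : 1000 * n ^ 4 * (8 * q + 8) = 8000 * n ^ 4 * (q + 1) := by ring
    rw [this]
    calc 8000 * n ^ 4 * (q + 1) ≤ 8000 * n ^ 4 * n := Nat.mul_le_mul_left _ hq
      _ = _ := by ring
  have hB2 : 1000 * n ^ 4 ≤ 8000 * n ^ 5 := by
    have : n ^ 4 ≤ n ^ 5 := Nat.pow_le_pow_right hn1 (by omega)
    omega
  obtain ⟨-, h8⟩ := h6 (FreeGroup α) (LFn α)
  obtain ⟨φ', g1, g2, g3⟩ := h8 FreeGroup.of 1 (8000 * n ^ 5) (by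
      intro l _ _; exact (FreeGroup.norm_of l.1).le) Xs3 UVs3 ws2 f1 f2 d2
    ⟨fun x hx => (f4 x hx).trans hB, fun u hu => ⟨(f5 u hu).1.trans hB, (f5 u hu).2.trans hB⟩,
      fun x hx => (d5 x hx).trans hB2⟩
  refine ⟨φ', g1, ?_, ?_⟩
  · rw [g2, NF, ← d3, f3, sqp, cmp]
  · intro x hx
    obtain ⟨A, s, D, hw, -⟩ := split_of_cnt_pos hx
    have k1 := g3 A ((x, s) :: D) hw.symm
    have k2 := g3 (A ++ [(x, s)]) D (by simp [hw])
    have k3 : evl φ' (x, s) = (ev φ' A)⁻¹ * ev φ' (A ++ [(x, s)]) := by simp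
    have k4 : (LFn α).ℓ (φ' x) = (LFn α).ℓ (evl φ' (x, s)) := ((LFn α).evl φ' (x, s)).symm
    have k5 := (LFn α).mul (ev φ' A)⁻¹ (ev φ' (A ++ [(x, s)]))
    rw [(LFn α).inv] at k5
    rw [k3] at k4
    rw [← hn] at k1 k2
    have k6 : n * (2 * (8000 * n ^ 5) + 1) = 16000 * n ^ 6 + n := by ring
    rw [k6] at k1 k2
    have : (φ' x).norm = (LFn α).ℓ (φ' x) := rfl
    omega

end
end Stmt8

namespace Stmt8
section

theorem exists_bad {γ : Type} {R : γ → γ → Prop} : ∀ {l : List γ}, ¬ l.IsChain R →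
    ∃ A x y D, l = A ++ x :: y :: D ∧ ¬ R x y := by
  intro l
  induction l with
  | nil => intro h; simp at h
  | cons x l ih =>
    intro h
    rcases l with _ | ⟨y, l⟩
    · simp at h
    · rw [List.isChain_cons_cons] at h
      by_cases hx : R x y
      · obtain ⟨A, u, v, D, e, h'⟩ := ih (fun h' => h ⟨hx, h'⟩)
        exact ⟨x :: A, u, v, D, by simp [e], h'⟩
      · exact ⟨[], x, y, l, rfl, hx⟩

theorem evl_evl {α β H : Type} [Group H] (φ : α → H) (ψ : β → H) (a : α) (b : β) (s r : Bool)
    (h : ψ b = evl φ (a, s)) : evl ψ (b, r) = evl φ (a, s == r) := by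
  cases s <;> cases r <;> simp [evl, h]

variable {S A : Type} [DecidableEq S] [DecidableEq A]

/-- value of the symbols -/
def vl (val : S → A × Bool) (s : S) : FreeGroup A := evl FreeGroup.of (val s)

theorem find_pair (val : S → A × Bool) (w : Wd S) (h : ev (vl val) w = 1) (hw : w ≠ []) :
    ∃ B e ε f δ D, w = B ++ (e, ε) :: (f, δ) :: D ∧ (val e).1 = (val f).1 ∧
      ((val e).2 == ε) ≠ ((val f).2 == δ) := by
  have h1 : FreeGroup.mk (w.map (fun l => ((val l.1).1, (val l.1).2 == l.2))) = 1 := by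
    rw [← ev_of, ← h, ev, ev, List.map_map]
    congr 1
    apply List.map_congr_left
    intro l _
    rcases l with ⟨s, r⟩
    simp only [Function.comp]
    rw [evl_evl (FreeGroup.of) (vl val) (val s).1 s (val s).2 r rfl]
  have h2 : ¬ FreeGroup.IsReduced (w.map (fun l => ((val l.1).1, (val l.1).2 == l.2))) := by
    intro h3
    have h4 := congrArg FreeGroup.toWord h1
    rw [FreeGroup.toWord_mk, FreeGroup.IsReduced.reduce_eq h3, FreeGroup.toWord_one] at h4
    exact hw (by simpa using h4)
  obtain ⟨B, x, y, D, e, hxy⟩ := exists_bad h2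
  rw [List.map_eq_append_iff] at e
  obtain ⟨B', R, rfl, -, e⟩ := e
  rw [List.map_eq_cons_iff] at e
  obtain ⟨l1, R, rfl, rfl, e⟩ := e
  rw [List.map_eq_cons_iff] at e
  obtain ⟨l2, D, rfl, rfl, e⟩ := e
  push Not at hxy
  exact ⟨B', l1.1, l1.2, l2.1, l2.2, D, rfl, hxy⟩

/-- conclusion of the chain lemma -/
def CC (val : S → A × Bool) (w : Wd S) (ψ : S → FreeGroup S) (t : S → S) (σ : S → Bool) : Prop :=
  ev ψ w = 1 ∧
  (∀ s, cnt w s = 1 → ψ s = evl FreeGroup.of (t s, σ s) ∧ vl val s = evl (vl val) (t s, σ s) ∧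
    0 < cnt w (t s)) ∧
  ∀ u, (∀ s, cnt w s = 1 → t s ≠ u) ∨ ∃ a b, a ≠ b ∧ cnt w a = 1 ∧ cnt w b = 1 ∧ t a = u ∧ t b = u ∧
    ∀ s, cnt w s = 1 → t s = u → s = a ∨ s = b

/-- renaming -/
def rn (e f : S) (σ : Bool) (l : S × Bool) : S × Bool := if l.1 = f then (e, σ == l.2) else l

theorem ev_rn {H : Type} [Group H] (ψ : S → H) (e f : S) (σ : Bool) (h : ψ f = evl ψ (e, σ))
    (w : Wd S) : ev ψ (w.map (rn e f σ)) = ev ψ w := by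
  induction w with
  | nil => rfl
  | cons l w ih =>
    rw [List.map_cons, ev_cons, ev_cons, ih]
    congr 1
    unfold rn
    split_ifs with hl
    · rcases l with ⟨x, r⟩
      simp only at hl
      subst hl
      exact (evl_evl ψ ψ e x σ r h).symm
    · rfl

theorem cnt_rn (e f : S) (hef : e ≠ f) (σ : Bool) (w : Wd S) :
    cnt (w.map (rn e f σ)) f = 0 ∧ cnt (w.map (rn e f σ)) e = cnt w e + cnt w f ∧
    ∀ s, s ≠ e → s ≠ f → cnt (w.map (rn e f σ)) s = cnt w s := by
  induction w with
  | nil => simp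
  | cons l w ih =>
    obtain ⟨h1, h2, h3⟩ := ih
    rw [List.map_cons]
    simp only [cnt_cons, h1, h2]
    rcases l with ⟨x, r⟩
    simp only [rn]
    refine ⟨?_, ?_, ?_⟩
    · by_cases hx : x = f
      · simp [hx, hef]
      · simp [hx]
    · by_cases hx : x = f
      · have : ¬ f = e := fun h => hef h.symm
        simp [hx, this]; omega
      · by_cases hy : x = e
        · subst hy; simp [hx]; omega
        · simp [hx, hy]
    · intro s hs hs'
      rw [h3 s hs hs']
      by_cases hx : x = f
      · have a : ¬ e = s := fun h => hs h.symm
        have b : ¬ f = s := fun h => hs' h.symm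
        simp [hx, a, b]
      · simp [hx]

theorem pair_cancel {H : Type} [Group H] (ψ : S → H) (e f : S) (ε δ : Bool)
    (h : ψ f = evl ψ (e, δ == !ε)) : evl ψ (e, ε) * evl ψ (f, δ) = 1 := by
  cases ε <;> cases δ <;> simp [evl, h]

theorem CL (val : S → A × Bool) (n : ℕ) : ∀ w : Wd S, w.length ≤ n → (∀ s, cnt w s ≤ 2) →
    ev (vl val) w = 1 → ∃ ψ t σ, CC val w ψ t σ := by
  induction n with
  | zero =>
    intro w hw _ _
    have : w = [] := List.eq_nil_of_length_eq_zero (by omega)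
    subst this
    exact ⟨FreeGroup.of, id, fun _ => true, by simp [CC]⟩
  | succ n ih =>
    intro w hw h2 he
    by_cases hnil : w = []
    · subst hnil
      exact ⟨FreeGroup.of, id, fun _ => true, by simp [CC]⟩
    obtain ⟨B, e, ε, f, δ, D, rfl, hv1, hv2⟩ := find_pair val w he hnil
    have hvf : vl val f = evl (vl val) (e, δ == !ε) := by
      unfold vl
      rcases hve : val e with ⟨x, r⟩
      rcases hvf : val f with ⟨y, r'⟩
      rw [hve, hvf] at hv1 hv2
      simp only at hv1 hv2
      subst hv1
      revert hv2
      cases r <;> cases r' <;> cases ε <;> cases δ <;> simp [evl, hve]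
    simp only [List.length_append, List.length_cons] at hw
    have hev : ∀ {H : Type} [Group H] (ψ : S → H), ψ f = evl ψ (e, δ == !ε) →
        ev ψ (B ++ (e, ε) :: (f, δ) :: D) = ev ψ (B ++ D) := by
      intro H _ ψ h
      rw [ev_append, ev_append, ev_cons, ev_cons, ← mul_assoc (evl ψ (e, ε)),
        pair_cancel ψ e f ε δ h, one_mul]
    by_cases hef : e = f
    · subst hef
      have hεδ : δ = !ε := by
        revert hv2
        cases (val e).2 <;> cases ε <;> cases δ <;> simp
      have hc : ∀ s, s ≠ e → cnt (B ++ (e, ε) :: (e, δ) :: D) s = cnt (B ++ D) s := by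
        intro s hs
        have : ¬ e = s := fun h => hs h.symm
        simp [this]
      have hce : cnt (B ++ D) e = 0 ∧ cnt (B ++ (e, ε) :: (e, δ) :: D) e = 2 := by
        have := h2 e
        simp at this ⊢
        omega
      have hc' : ∀ s, cnt (B ++ (e, ε) :: (e, δ) :: D) s = 1 ↔ cnt (B ++ D) s = 1 := by
        intro s
        by_cases hs : s = e
        · subst hs; omega
        · rw [hc s hs]
      obtain ⟨ψ, t, σ, i1, i2, i3⟩ := ih (B ++ D) (by simp; omega) (fun s => by
        have := h2 s; simp at this ⊢; omega) (by rw [← hev (vl val) hvf, he])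
      refine ⟨ψ, t, σ, ?_, ?_, ?_⟩
      · rw [hev, i1]
        simp [hεδ, evl]
      · intro s hs
        obtain ⟨j1, j2, j3⟩ := i2 s ((hc' s).1 hs)
        refine ⟨j1, j2, ?_⟩
        by_cases hts : t s = e
        · rw [hts]; omega
        · rw [hc _ hts]; exact j3
      · simp only [hc']
        exact i3
    · obtain ⟨σ0, hσ0⟩ : ∃ σ0, σ0 = (δ == !ε) := ⟨_, rfl⟩
      rw [← hσ0] at hvf hev
      obtain ⟨k1, k2, k3⟩ := cnt_rn e f hef σ0 (B ++ D)
      have hfe : ¬ f = e := fun h => hef h.symm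
      have hc : ∀ s, s ≠ e → s ≠ f → cnt (B ++ (e, ε) :: (f, δ) :: D) s = cnt (B ++ D) s := by
        intro s hs hs'
        have a : ¬ e = s := fun h => hs h.symm
        have b : ¬ f = s := fun h => hs' h.symm
        simp [a, b]
      have hce : cnt (B ++ (e, ε) :: (f, δ) :: D) e = cnt (B ++ D) e + 1 := by
        simp [hfe]; omega
      have hcf : cnt (B ++ (e, ε) :: (f, δ) :: D) f = cnt (B ++ D) f + 1 := by
        simp [hef]; omega
      have h2e := h2 e
      have h2f := h2 f
      obtain ⟨w', hw'⟩ : ∃ w', w' = (B ++ D).map (rn e f σ0) := ⟨_, rfl⟩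
      rw [← hw'] at k1 k2 k3
      obtain ⟨ψ, t, σ, i1, i2, i3⟩ := ih w' (by rw [hw']; simp; omega) (by
        intro s
        by_cases hs : s = e
        · subst hs; omega
        · by_cases hs' : s = f
          · subst hs'; omega
          · rw [k3 s hs hs', ← hc s hs hs']; exact h2 s) (by
          rw [hw', ev_rn _ _ _ _ hvf, ← hev (vl val) hvf, he])
      obtain ⟨w, hww⟩ : ∃ w, w = (B ++ (e, ε) :: (f, δ) :: D) := ⟨_, rfl⟩
      rw [← hww] at he h2 h2e h2f hc hce hcf ⊢
      have hev' : ∀ ψ : S → FreeGroup S, ψ f = evl ψ (e, σ0) → ev ψ w = ev ψ w' := by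
        intro ψ h
        rw [hww, hev ψ h, hw', ev_rn _ _ _ _ h]
      have hwc : ∀ s, s ≠ e → s ≠ f → cnt w s = cnt w' s := fun s hs hs' => by
        rw [hc s hs hs', k3 s hs hs']
      have hwpos : ∀ s, 0 < cnt w' s → 0 < cnt w s := by
        intro s h
        by_cases hs : s = e
        · subst hs; omega
        · by_cases hs' : s = f
          · subst hs'; omega
          · rw [hwc s hs hs']; exact h
      by_cases hz : cnt w' e = 0
      · -- both are constants
        refine ⟨Function.update (Function.update ψ e (FreeGroup.of e)) f
          (evl FreeGroup.of (e, σ0)), Function.update (Function.update t e e) f e,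
          Function.update (Function.update σ e true) f σ0, ?_, ?_, ?_⟩
        · rw [hev', ev_update _ _ _ k1, ev_update _ _ _ hz, i1]
          simp [evl, hef]
        · intro s hs
          by_cases hs1 : s = f
          · subst hs1
            simp only [Function.update_self]
            exact ⟨trivial, hvf, by omega⟩
          · by_cases hs2 : s = e
            · subst hs2
              simp only [Function.update_self, Function.update_of_ne hs1]
              exact ⟨by simp [evl], by simp [evl], by omega⟩
            · simp only [Function.update_of_ne hs1, Function.update_of_ne hs2]
              obtain ⟨j1, j2, j3⟩ := i2 s (by rw [← hwc s hs2 hs1]; exact hs)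
              exact ⟨j1, j2, hwpos _ j3⟩
        · intro u
          by_cases hu : u = e
          · subst hu
            right
            refine ⟨u, f, hef, by omega, by omega, by simp [Function.update_of_ne hef], by simp, ?_⟩
            intro s hs hts
            by_contra hcon
            push Not at hcon
            rw [Function.update_of_ne hcon.2, Function.update_of_ne hcon.1] at hts
            have := (i2 s (by rw [← hwc s hcon.1 hcon.2]; exact hs)).2.2
            rw [hts] at this
            omega
          · have heu : ¬ e = u := fun h => hu h.symm
            rcases i3 u with h | ⟨a, b, hab, ha, hb, hta, htb, hun⟩
            · left
              intro s hs
              by_cases hs1 : s = f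
              · subst hs1; simpa using heu
              · by_cases hs2 : s = e
                · subst hs2; simpa [Function.update_of_ne hs1] using heu
                · rw [Function.update_of_ne hs1, Function.update_of_ne hs2]
                  exact h s (by rw [← hwc s hs2 hs1]; exact hs)
            · right
              have key : ∀ a, cnt w' a = 1 → a ≠ e ∧ a ≠ f := by
                intro a ha
                constructor
                · rintro rfl; omega
                · rintro rfl; omega
              obtain ⟨ae, af⟩ := key a ha
              obtain ⟨be, bf⟩ := key b hb
              refine ⟨a, b, hab, by rw [hwc a ae af, ha], by rw [hwc b be bf, hb], ?_, ?_, ?_⟩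
              · rw [Function.update_of_ne af, Function.update_of_ne ae, hta]
              · rw [Function.update_of_ne bf, Function.update_of_ne be, htb]
              · intro s hs hts
                by_cases hs1 : s = f
                · subst hs1; exact absurd hts (by simpa using heu)
                · by_cases hs2 : s = e
                  · subst hs2; exact absurd hts (by simpa [Function.update_of_ne hs1] using heu)
                  · rw [Function.update_of_ne hs1, Function.update_of_ne hs2] at hts
                    exact hun s (by rw [← hwc s hs2 hs1]; exact hs) hts
      · refine ⟨Function.update ψ f (evl ψ (e, σ0)), Function.update t f (t e),
          Function.update σ f (σ e == σ0), ?_, ?_, ?_⟩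
        · rw [hev', ev_update _ _ _ k1, i1]
          simp [evl, hef]
        · intro s hs
          by_cases hs1 : s = f
          · subst hs1
            simp only [Function.update_self]
            obtain ⟨j1, j2, j3⟩ := i2 e (by omega)
            refine ⟨evl_evl _ _ _ _ _ _ j1, ?_, hwpos _ j3⟩
            rw [hvf]
            exact evl_evl _ _ _ _ _ _ j2
          · simp only [Function.update_of_ne hs1]
            have : cnt w' s = 1 := by
              by_cases hs2 : s = e
              · subst hs2; omega
              · rw [← hwc s hs2 hs1]; exact hs
            obtain ⟨j1, j2, j3⟩ := i2 s this
            exact ⟨j1, j2, hwpos _ j3⟩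
        · intro u
          -- constants of w' correspond to constants of w
          have back : ∀ s, cnt w s = 1 → ∃ s', cnt w' s' = 1 ∧
              (Function.update t f (t e)) s = t s' ∧ (s = s' ∨ (s = f ∧ s' = e)) := by
            intro s hs
            by_cases hs1 : s = f
            · subst hs1
              exact ⟨e, by omega, by simp, by simp⟩
            · refine ⟨s, ?_, by rw [Function.update_of_ne hs1], by simp⟩
              by_cases hs2 : s = e
              · subst hs2; omega
              · rw [← hwc s hs2 hs1]; exact hs
          have forw : ∀ s', cnt w' s' = 1 → ∃ s, cnt w s = 1 ∧
              (Function.update t f (t e)) s = t s' ∧ (s = s' ∨ (s = f ∧ s' = e)) := by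
            intro s hs
            have hsf : s ≠ f := by rintro rfl; omega
            by_cases hs2 : s = e
            · subst hs2
              by_cases h0 : cnt (B ++ D) s = 0
              · exact ⟨s, by omega, by rw [Function.update_of_ne hsf], by simp⟩
              · exact ⟨f, by omega, by simp, by simp⟩
            · exact ⟨s, by rw [hwc s hs2 hsf, hs], by rw [Function.update_of_ne hsf], by simp⟩
          have nb : ¬ (cnt w e = 1 ∧ cnt w f = 1) := by omega
          rcases i3 u with h | ⟨a, b, hab, ha, hb, hta, htb, hun⟩
          · left
            intro s hs hts
            obtain ⟨s', h1, h2, -⟩ := back s hs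
            exact h s' h1 (by rw [← h2, hts])
          · right
            obtain ⟨a', a1, a2, a3⟩ := forw a ha
            obtain ⟨b', b1, b2, b3⟩ := forw b hb
            have haf : a ≠ f := by rintro rfl; omega
            have hbf : b ≠ f := by rintro rfl; omega
            refine ⟨a', b', ?_, a1, b1, by rw [a2, hta], by rw [b2, htb], ?_⟩
            · grind
            · intro s hs hts
              obtain ⟨s', h1, h2, h3⟩ := back s hs
              have := hun s' h1 (by rw [← h2, hts])
              grind
end
end Stmt8

namespace Stmt8
section
variable {X A : Type} [DecidableEq X] [DecidableEq A]

/-- label the constants of a word by positions. -/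
theorem lin [Inhabited A] : ∀ q : Wd (X ⊕ A), ∃ (p : Wd (X ⊕ ℕ)) (va : ℕ → A),
    q = p.map (fun l => (Sum.map id va l.1, l.2)) ∧ (∀ j, cnt p (Sum.inr j) ≤ 1) ∧
    (∀ j, q.length ≤ j → cnt p (Sum.inr j) = 0) := by
  intro q
  induction q with
  | nil => exact ⟨[], fun _ => default, by simp⟩
  | cons l q ih =>
    obtain ⟨p, va, h1, h2, h3⟩ := ih
    rcases l with ⟨x | a, s⟩
    · refine ⟨(Sum.inl x, s) :: p, va, by simp [← h1], by simpa using h2, ?_⟩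
      intro j hj
      have := h3 j (by simp at hj; omega)
      simpa using this
    · refine ⟨(Sum.inr q.length, s) :: p, Function.update va q.length a, ?_, ?_, ?_⟩
      · rw [List.map_cons]
        congr 1
        · simp
        · conv_lhs => rw [h1]
          apply List.map_congr_left
          rintro ⟨y, r⟩ hl
          have h4 := cnt_eq_zero.1 (h3 q.length le_rfl) _ hl
          rcases y with y | j
          · rfl
          · have : j ≠ q.length := fun e => h4 (by rw [e])
            simp [Function.update_of_ne this]
      · intro j
        by_cases hj : q.length = j
        · subst hj
          have := h3 q.length le_rfl
          simp [this]
        · have := h2 j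
          simp [hj, this]
      · intro j hj
        simp only [List.length_cons] at hj
        have := h3 j (by omega)
        have hj' : ¬ q.length = j := by omega
        simp [this, hj']

/-- substitution of words -/
def sb {α β : Type} (E : α → Wd β) (p : Wd α) : Wd β :=
  (p.map (fun l => cond l.2 (E l.1) (FreeGroup.invRev (E l.1)))).flatten

theorem ev_sb {α β H : Type} [Group H] (E : α → Wd β) (ψ : β → H) (p : Wd α) :
    ev ψ (sb E p) = ev (fun a => ev ψ (E a)) p := by
  induction p with
  | nil => rfl
  | cons l p ih =>
    have : sb E (l :: p) = cond l.2 (E l.1) (FreeGroup.invRev (E l.1)) ++ sb E p := by simp [sb]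
    rw [this, ev_append, ih, ev_cons]
    rcases l with ⟨a, s⟩
    cases s <;> simp [evl]

theorem cnt_sb {α β : Type} [DecidableEq α] [DecidableEq β] (E : α → Wd β) (π : β → α) (s : β)
    (h : ∀ a, a ≠ π s → cnt (E a) s = 0) (p : Wd α) :
    cnt (sb E p) s = cnt p (π s) * cnt (E (π s)) s := by
  induction p with
  | nil => simp [sb]
  | cons l p ih =>
    have : sb E (l :: p) = cond l.2 (E l.1) (FreeGroup.invRev (E l.1)) ++ sb E p := by simp [sb]
    rw [this, cnt_append, ih, cnt_cons]
    have h' : cnt (cond l.2 (E l.1) (FreeGroup.invRev (E l.1))) s = cnt (E l.1) s := by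
      cases l.2 <;> simp
    rw [h']
    by_cases hl : l.1 = π s
    · simp [hl]; ring
    · simp [hl, h l.1 hl]

/-- expansion of the letters -/
def Ex (len : X → ℕ) : X ⊕ ℕ → Wd ((X × ℕ) ⊕ ℕ)
  | Sum.inl x => (List.range (len x)).map (fun i => (Sum.inl (x, i), true))
  | Sum.inr j => [(Sum.inr j, true)]

/-- owner of a symbol -/
def ow : (X × ℕ) ⊕ ℕ → X ⊕ ℕ
  | Sum.inl y => Sum.inl y.1
  | Sum.inr j => Sum.inr j

theorem cnt_Ex_other (len : X → ℕ) (s : (X × ℕ) ⊕ ℕ) (a : X ⊕ ℕ) (h : a ≠ ow s) :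
    cnt (Ex len a) s = 0 := by
  rw [cnt_eq_zero]
  intro l hl e
  rcases a with x | j
  · simp only [Ex, List.mem_map] at hl
    obtain ⟨i, -, rfl⟩ := hl
    simp only at e
    subst e
    exact h rfl
  · simp only [Ex, List.mem_singleton] at hl
    subst hl
    simp only at e
    subst e
    exact h rfl

theorem cnt_nodup {α : Type} [DecidableEq α] {w : Wd α} (h : (w.map Prod.fst).Nodup) (a : α) :
    cnt w a ≤ 1 := List.nodup_iff_count_le_one.1 h a

theorem cnt_Ex_le (len : X → ℕ) (s : (X × ℕ) ⊕ ℕ) : cnt (Ex len (ow s)) s ≤ 1 := by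
  rcases s with ⟨x, i⟩ | j
  · apply cnt_nodup
    simp only [ow, Ex, List.map_map]
    apply List.Nodup.map _ List.nodup_range
    intro i j h
    simpa using h
  · simp [ow, Ex]

/-- value of a symbol -/
def symval [Inhabited A] (g : X → FreeGroup A) (va : ℕ → A) : (X × ℕ) ⊕ ℕ → A × Bool
  | Sum.inl y => (g y.1).toWord.getD y.2 (default, true)
  | Sum.inr j => (va j, true)

theorem ev_Ex [Inhabited A] (g : X → FreeGroup A) (va : ℕ → A) (x : X) :
    ev (vl (symval g va)) (Ex (fun x => (g x).toWord.length) (Sum.inl x)) = g x := by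
  conv_rhs => rw [← FreeGroup.mk_toWord (x := g x), ← ev_of]
  simp only [Ex, ev, List.map_map]
  congr 1
  apply List.ext_getElem
  · simp
  · intro i h1 h2
    simp only [List.length_map] at h2
    simp [vl, evl, symval, h2]

/-- replacing the letters of a word: counting -/
theorem cnt_map_pair {α β : Type} [DecidableEq α] [DecidableEq β] (f : α × Bool → β × Bool) (v : β)
    (a b : α) (hab : a ≠ b) (p : Wd α) (h : ∀ l ∈ p, (f l).1 = v ↔ (l.1 = a ∨ l.1 = b)) :
    cnt (p.map f) v = cnt p a + cnt p b := by
  induction p with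
  | nil => simp
  | cons l p ih =>
    have h1 := h l (by simp)
    rw [List.map_cons, cnt_cons, cnt_cons, cnt_cons, ih (fun l hl => h l (by simp [hl]))]
    by_cases ha : l.1 = a
    · have hb : ¬ l.1 = b := fun e => hab (ha ▸ e)
      have : (f l).1 = v := h1.2 (Or.inl ha)
      simp only [this, ha, if_true, if_neg hab]; omega
    · by_cases hb : l.1 = b
      · have : (f l).1 = v := h1.2 (Or.inr hb)
        have hba : ¬ b = a := fun e => hab e.symm
        simp only [this, hb, if_true, if_neg hba]; omega
      · have : ¬ (f l).1 = v := fun e => by rcases h1.1 e with h | h <;> contradiction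
        simp [this, ha, hb]

theorem cnt_map_single {α β : Type} [DecidableEq α] [DecidableEq β] (f : α × Bool → β × Bool) (v : β)
    (a : α) (p : Wd α) (h : ∀ l ∈ p, (f l).1 = v ↔ l.1 = a) :
    cnt (p.map f) v = cnt p a := by
  induction p with
  | nil => simp
  | cons l p ih =>
    have h1 := h l (by simp)
    rw [List.map_cons, cnt_cons, cnt_cons, ih (fun l hl => h l (by simp [hl]))]
    simp only [h1]

end
end Stmt8

namespace Stmt8
section

theorem ev_map_congr {α β H : Type} [Group H] (φ : β → H) (χ : α → H) (F : α × Bool → β × Bool)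
    (p : Wd α) (h : ∀ l ∈ p, evl φ (F l) = evl χ l) : ev φ (p.map F) = ev χ p := by
  rw [ev, ev, List.map_map]
  congr 1
  exact List.map_congr_left h

/-- signed count -/
def scnt {α : Type} [DecidableEq α] (w : Wd α) (x : α) (s : Bool) : ℕ :=
  (w.filter fun l => decide (l.1 = x) && (l.2 == s)).length

theorem scnt_count {α : Type} [DecidableEq α] (w : Wd α) (x : α) (s : Bool) :
    w.count (x, s) = scnt w x s := by
  rw [scnt, ← List.countP_eq_length_filter, List.count]
  apply List.countP_congr
  rintro ⟨y, r⟩ _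
  simp

theorem scnt_map {α β : Type} [DecidableEq α] [DecidableEq β] (f : α × Bool → β × Bool) (x : α)
    (y : β) (s : Bool) (p : Wd α)
    (h : ∀ l ∈ p, ((f l).1 = y ∧ (f l).2 = s) ↔ (l.1 = x ∧ l.2 = s)) :
    scnt (p.map f) y s = scnt p x s := by
  rw [scnt, scnt, ← List.countP_eq_length_filter, ← List.countP_eq_length_filter, List.countP_map]
  apply List.countP_congr
  intro l hl
  have := h l hl
  simpa using this

theorem cnt_filter {α : Type} [DecidableEq α] (w : Wd α) (x : α) :
    (w.filter fun l => decide (l.1 = x)).length = cnt w x := by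
  rw [cnt, ← List.countP_eq_length_filter, List.count, List.countP_map]
  apply List.countP_congr
  intro l _
  simp

theorem MG2 {α : Type} [DecidableEq α] (S : Set α) (w : Wd α)
    (hS : ∀ a, cnt w a = 0 ∨ cnt w a = 2)
    (hno : ∃ x ∈ S, ∃ s, scnt w x s = 2) (φ : α → FreeGroup α)
    (hφ : ∀ a, a ∉ S → φ a = FreeGroup.of a) (he : ev φ w = 1) :
    ∃ φ' : α → FreeGroup α, (∀ a, a ∉ S → φ' a = FreeGroup.of a) ∧ ev φ' w = 1 ∧
      ∀ x, 0 < cnt w x → (φ' x).norm ≤ 32002 * w.length ^ 6 := by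
  refine MG S w hS ?_ φ hφ he
  obtain ⟨x, hx, s, h⟩ := hno
  exact ⟨x, hx, s, by rw [scnt_count, h]⟩

variable {X A : Type} [DecidableEq X] [DecidableEq A]

theorem main_words [Inhabited A] (q : Wd (X ⊕ A)) (hq : ∀ x, cnt q (Sum.inl x) = 2)
    (hno : ∃ x s, scnt q (Sum.inl x) s = 2) (g : X → FreeGroup A)
    (he : ev (Sum.elim g FreeGroup.of) q = 1) :
    ∃ g' : X → FreeGroup A, ev (Sum.elim g' FreeGroup.of) q = 1 ∧
      ∀ x, (g' x).norm ≤ 32002 * q.length ^ 6 := by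
  obtain ⟨p, va, h1, h2, -⟩ := lin q
  obtain ⟨val, hval⟩ : ∃ val : (X × ℕ) ⊕ ℕ → A × Bool, val = symval g va := ⟨_, rfl⟩
  obtain ⟨E, hE⟩ : ∃ E, E = Ex (fun x => (g x).toWord.length) := ⟨_, rfl⟩
  have hp : ∀ x, cnt p (Sum.inl x) = 2 := by
    intro x
    rw [← hq x, h1]
    symm
    apply cnt_map_single
    rintro ⟨y | j, s⟩ _ <;> simp
  have hev : ∀ g' : X → FreeGroup A, ev (Sum.elim g' FreeGroup.of) q =
      ev (Sum.elim g' (fun j => vl val (Sum.inr j))) p := by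
    intro g'
    rw [h1]
    apply ev_map_congr
    rintro ⟨y | j, s⟩ _
    · simp [evl]
    · simp [evl, vl, hval, symval]
  have hvE : ∀ a, ev (vl val) (E a) = Sum.elim g (fun j => vl val (Sum.inr j)) a := by
    rintro (x | j)
    · rw [hval, hE, ev_Ex]; rfl
    · simp [hE, Ex, evl]
  have hcW : ∀ s, cnt (sb E p) s = cnt p (ow s) * cnt (E (ow s)) s := by
    intro s
    apply cnt_sb
    intro a ha
    rw [hE]
    exact cnt_Ex_other _ s a ha
  have hle : ∀ s, cnt (E (ow s)) s ≤ 1 := fun s => by rw [hE]; exact cnt_Ex_le _ s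
  have hcl : ∀ s, cnt (sb E p) s ≤ 2 := by
    intro s
    rw [hcW]
    have a1 := hle s
    have a2 : cnt p (ow s) ≤ 2 := by
      rcases s with ⟨x, i⟩ | j
      · exact (hp x).le
      · exact (h2 j).trans (by omega)
    nlinarith
  have hcj : ∀ j, cnt (sb E p) (Sum.inr j) = cnt p (Sum.inr j) := by
    intro j
    rw [hcW, hE]
    simp [ow, Ex]
  have hci : ∀ y, cnt (sb E p) (Sum.inl y) ≠ 1 := by
    intro y
    rw [hcW]
    simp only [ow, hp]
    omega
  obtain ⟨ψ, t, σ, c1, c2, c3⟩ := CL val _ (sb E p) le_rfl hcl (by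
    rw [ev_sb]
    rw [hev] at he
    rw [← he]
    apply ev_congr
    intro l _
    exact hvE l.1)
  obtain ⟨F, hF⟩ : ∃ F : (X ⊕ ℕ) × Bool → (X ⊕ ((X × ℕ) ⊕ ℕ)) × Bool, F = (fun l => match l with
      | (Sum.inl x, s) => (Sum.inl x, s)
      | (Sum.inr j, s) => (Sum.inr (t (Sum.inr j)), σ (Sum.inr j) == s)) := ⟨_, rfl⟩
  have hFl : ∀ x s, F (Sum.inl x, s) = (Sum.inl x, s) := by intro x s; rw [hF]
  have hFr : ∀ j s, F (Sum.inr j, s) = (Sum.inr (t (Sum.inr j)), σ (Sum.inr j) == s) := by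
    intro j s; rw [hF]
  clear hF
  have hmem : ∀ j s, (Sum.inr j, s) ∈ p → cnt (sb E p) (Sum.inr j) = 1 := by
    intro j s h
    rw [hcj]
    have : 0 < cnt p (Sum.inr j) := cnt_pos.2 ⟨_, h, rfl⟩
    have := h2 j
    omega
  have hcF : ∀ a, cnt (p.map F) a = 0 ∨ cnt (p.map F) a = 2 := by
    rintro (x | u)
    · right
      rw [← hp x]
      apply cnt_map_single
      rintro ⟨y | j, s⟩ _
      · rw [hFl]; simp
      · rw [hFr]; simp
    · rcases c3 u with h | ⟨a, b, hab, ha, hb, hta, htb, hun⟩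
      · left
        rw [cnt_eq_zero]
        intro l hl
        obtain ⟨⟨y | j, s⟩, hl', rfl⟩ := List.mem_map.1 hl
        · rw [hFl]; simp
        · rw [hFr]
          have := h _ (hmem j s hl')
          simpa using this
      · right
        rcases a with a | a
        · exact absurd ha (hci a)
        rcases b with b | b
        · exact absurd hb (hci b)
        rw [cnt_map_pair F (Sum.inr u) (Sum.inr a) (Sum.inr b) (fun e => hab (by
          rw [Sum.inr.inj e]))]
        · rw [← hcj, ← hcj, ha, hb]
        · rintro ⟨y | j, s⟩ hl
          · rw [hFl]; simp
          · rw [hFr]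
            have := hun (Sum.inr j) (hmem j s hl)
            simp only [Sum.inr.injEq] at this ⊢
            constructor
            · exact this
            · rintro (rfl | rfl)
              · exact hta
              · exact htb
  obtain ⟨φ', d1, d2, d3⟩   := MG2 (Set.range Sum.inl) (p.map F) hcF (by
      obtain ⟨x, s, hx⟩ := hno
      refine ⟨Sum.inl x, ⟨x, rfl⟩, s, ?_⟩
      rw [← hx, h1]
      rw [scnt_map F (Sum.inl x), scnt_map _ (Sum.inl x)]
      · rintro ⟨y | j, s⟩ hl <;> simp
      · rintro ⟨y | j, s⟩ hl
        · rw [hFl]; simp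
        · rw [hFr]; simp)
    (Sum.elim (fun x => FreeGroup.map Sum.inr (ev ψ (E (Sum.inl x)))) (fun u => FreeGroup.of (Sum.inr u)))
    (by
      rintro (x | u) h
      · exact absurd ⟨x, rfl⟩ h
      · rfl)
    (by
      rw [ev_map_congr _ (fun a => FreeGroup.map Sum.inr (ev ψ (E a)))]
      · rw [← ev_hom, ← ev_sb, c1, map_one]
      · rintro ⟨y | j, s⟩ hl
        · rw [hFl]; simp [evl]
        · rw [hFr]
          symm
          apply evl_evl
          have := (c2 _ (hmem j s hl)).1
          simp only [hE, Ex, ev_cons, ev_nil, mul_one, evl, cond_true]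
          rw [this]
          cases σ (Sum.inr j) <;> simp [evl])
  obtain ⟨Θ, hΘ⟩ : ∃ Θ : X ⊕ ((X × ℕ) ⊕ ℕ) → FreeGroup A, Θ = Sum.elim (fun _ => 1) (vl val) :=
    ⟨_, rfl⟩
  refine ⟨fun x => FreeGroup.lift Θ (φ' (Sum.inl x)), ?_, ?_⟩
  · rw [hev]
    have := congrArg (FreeGroup.lift Θ) d2
    rw [map_one, ev_hom] at this
    rw [← this]
    symm
    apply ev_map_congr
    rintro ⟨y | j, s⟩ hl
    · rw [hFl]; simp [evl]
    · rw [hFr]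
      symm
      apply evl_evl
      simp only [Sum.elim_inr]
      rw [(c2 _ (hmem j s hl)).2.1]
      have : φ' (Sum.inr (t (Sum.inr j))) = FreeGroup.of (Sum.inr (t (Sum.inr j))) :=
        d1 _ (by simp)
      simp [evl, this, hΘ]
  · intro x
    have k1 := d3 (Sum.inl x) (by
      have := hp x
      rw [cnt_map_single F (Sum.inl x) (Sum.inl x), this]
      · omega
      · rintro ⟨y | j, s⟩ _
        · rw [hFl]; simp
        · rw [hFr]; simp)
    have k2 : (p.map F).length = q.length := by rw [h1]; simp
    rw [k2] at k1
    refine le_trans ?_ k1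
    show (FreeGroup.lift Θ (φ' (Sum.inl x))).norm ≤ _
    have kk : FreeGroup.lift Θ (φ' (Sum.inl x)) = ev Θ (φ' (Sum.inl x)).toWord := by
      rw [← lift_mk_ev, FreeGroup.mk_toWord]
    rw [kk]
    have := (LFn A).ev Θ (φ' (Sum.inl x)).toWord 1 (by
      rintro ⟨y | u, s⟩ _
      · rw [hΘ]; simp [(LFn A).one]
      · rw [hΘ]
        simp only [Sum.elim_inr, vl]
        rw [(LFn A).evl]
        exact (FreeGroup.norm_of (val u).1).le)
    rw [mul_one] at this
    exact this

end

/-- In a free group F of finite rank ≥ 2, every solvable non-orientable quadratic equation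
Q = 1 has a solution φ with |φ(x)| ≤ N·|Q|¹⁶ for every variable x, where N depends only
on F and |Q| is the length of Q as a reduced word in F(X ∪ A). -/
theorem nonorientable_quadratic_minimal_solution_bound_free (r : ℕ) (hr : 2 ≤ r) :
    ∃ N : ℕ, ∀ (nv : ℕ) (Q : FreeGroup (Fin nv ⊕ Fin r)),
      (∀ x : Fin nv, occ Q x = 2) →
      (∃ x : Fin nv, occS Q x true = 2 ∨ occS Q x false = 2) →
      (∃ φ, IsSol Q φ) →
      ∃ φ, IsSol Q φ ∧
        ∀ x : Fin nv, len (φ (FreeGroup.of (Sum.inl x))) ≤ N * Q.toWord.length ^ 16 := by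
  refine ⟨32002, ?_⟩
  intro nv Q hocc hno hsol
  have : Inhabited (Fin r) := ⟨⟨0, by omega⟩⟩
  obtain ⟨φ, hφ1, hφ2⟩ := hsol
  have key : ∀ g : Fin nv → FreeGroup (Fin r),
      FreeGroup.lift (Sum.elim g FreeGroup.of) Q = ev (Sum.elim g FreeGroup.of) Q.toWord := by
    intro g
    rw [← lift_mk_ev, FreeGroup.mk_toWord]
  obtain ⟨g', h1, h2⟩ := main_words Q.toWord (fun x => by
      rw [← cnt_filter, ← hocc x]; rfl) (by
      obtain ⟨x, h | h⟩ := hno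
      · exact ⟨x, true, h⟩
      · exact ⟨x, false, h⟩) (fun x => φ (FreeGroup.of (Sum.inl x))) (by
      rw [← key, ← hφ2]
      congr 1
      ext a
      rcases a with x | a
      · simp
      · simp [hφ1])
  refine ⟨FreeGroup.lift (Sum.elim g' FreeGroup.of), ⟨by simp, by rw [key, h1]⟩, ?_⟩
  intro x
  simp only [FreeGroup.lift_apply_of, Sum.elim_inl]
  refine (h2 x).trans (Nat.mul_le_mul_left _ ?_)
  have : 0 < Q.toWord.length := by
    have a := hocc x
    have b : occ Q x ≤ Q.toWord.length := List.length_filter_le _ _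
    omega
  exact Nat.pow_le_pow_right this (by omega)

end Stmt8
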